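/- arXiv:1809.00401 — 2 statements merged into one kernel-verified Lean document; each statement's English description precedes it below -/
import Mathlib

section
/- For every natural number n with 1 ≤ n ≤ 3, every Darboux bijection f : Sⁿ → Sⁿ of the n-dimensional sphere Sⁿ = {x ∈ ℝⁿ⁺¹ : ‖x‖ = 1} onto itself is a homeomorphism. -/
open Set Topology

section Separation

variable {X Y : Type*} [TopologicalSpace X] [TopologicalSpace Y]

/-- In a completely normal space, two disjoint open sets split any set which is
not preconnected. -/
theorem exists_disjoint_isOpen_of_not_isPreconnected [CompletelyNormalSpace X] {s : Set X}
    (hs : ¬ IsPreconnected s) :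
    ∃ U V : Set X, IsOpen U ∧ IsOpen V ∧ Disjoint U V ∧ s ⊆ U ∪ V ∧
      (s ∩ U).Nonempty ∧ (s ∩ V).Nonempty := by
  unfold IsPreconnected at hs
  push Not at hs
  obtain ⟨u, v, hu, hv, hsuv, hsu, hsv, hempty⟩ := hs
  have h₁ : Disjoint (closure (s ∩ u)) (s ∩ v) := by
    refine Disjoint.mono_right inter_subset_right (Disjoint.closure_left ?_ hv)
    rw [disjoint_left]
    rintro x ⟨hxs, hxu⟩ hxv
    exact (hempty ▸ (⟨hxs, hxu, hxv⟩ : x ∈ s ∩ (u ∩ v)) : x ∈ (∅ : Set X))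
  have h₂ : Disjoint (s ∩ u) (closure (s ∩ v)) := by
    refine Disjoint.mono_left inter_subset_right (Disjoint.closure_right ?_ hu)
    rw [disjoint_left]
    rintro x hxu ⟨hxs, hxv⟩
    exact (hempty ▸ (⟨hxs, hxu, hxv⟩ : x ∈ s ∩ (u ∩ v)) : x ∈ (∅ : Set X))
  obtain ⟨U, V, hU, hV, hsU, hsV, hUV⟩ :=
    separatedNhds_iff_disjoint.2 (CompletelyNormalSpace.completely_normal h₁ h₂)
  refine ⟨U, V, hU, hV, hUV, fun x hx => ?_, ?_, ?_⟩
  · exact (hsuv hx).imp (fun h => hsU ⟨hx, h⟩) (fun h => hsV ⟨hx, h⟩)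
  · exact hsu.mono fun x hx => ⟨hx.1, hsU hx⟩
  · exact hsv.mono fun x hx => ⟨hx.1, hsV hx⟩

/-- If `K` is closed and `K \ N` is not preconnected, then `K` is the union of two
proper closed subsets which meet inside `N`. -/
theorem exists_isClosed_union_of_not_isPreconnected_diff [CompletelyNormalSpace X]
    {K N : Set X} (hK : IsClosed K) (h : ¬ IsPreconnected (K \ N)) :
    ∃ A B : Set X, IsClosed A ∧ IsClosed B ∧ A ∪ B = K ∧ A ≠ K ∧ B ≠ K ∧ A ∩ B ⊆ N := by
  obtain ⟨U, V, hU, hV, hUV, hsub, ⟨x, hxK, hxU⟩, ⟨y, hyK, hyV⟩⟩ :=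
    exists_disjoint_isOpen_of_not_isPreconnected h
  refine ⟨K \ U, K \ V, hK.sdiff hU, hK.sdiff hV, ?_, fun h => ?_, fun h => ?_, ?_⟩
  · rw [← sdiff_inter, hUV.inter_eq, sdiff_empty]
  · exact (h.symm ▸ hxK.1 : x ∈ K \ U).2 hxU
  · exact (h.symm ▸ hyK.1 : y ∈ K \ V).2 hyV
  · rintro z ⟨⟨hzK, hzU⟩, -, hzV⟩
    by_contra hzN
    exact (hsub ⟨hzK, hzN⟩).elim hzU hzV

/-- A set which misses a level of a continuous real function but meets both sides of it is not
preconnected. -/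
theorem not_isPreconnected_of_forall_ne {s : Set X} {g : X → ℝ} (hg : ContinuousOn g s) {c : ℝ}
    (hne : ∀ x ∈ s, g x ≠ c) {a b : X} (ha : a ∈ s) (hb : b ∈ s) (hac : g a < c) (hcb : c < g b) :
    ¬ IsPreconnected s := fun hs => by
  obtain ⟨x, hx, rfl⟩ := hs.intermediate_value ha hb hg ⟨hac.le, hcb.le⟩
  exact hne x hx rfl

/-- A property of closed sets that spreads from a closed set to a neighbourhood and fails on a
compact set fails on a minimal closed subset of it. -/
theorem exists_minimal_isClosed_of_not [T2Space X] {L : Set X} (hL : IsCompact L)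
    {P : Set X → Prop}
    (hP : ∀ K ⊆ L, IsClosed K → P K → ∃ N, IsOpen N ∧ K ⊆ N ∧ ∀ M ⊆ L ∩ N, IsClosed M → P M)
    (hPL : ¬ P L) :
    ∃ K ⊆ L, IsClosed K ∧ ¬ P K ∧ ∀ M ⊆ K, IsClosed M → M ≠ K → P M := by
  have hzorn : ∀ c ⊆ {K | K ⊆ L ∧ IsClosed K ∧ ¬ P K}, IsChain (· ⊆ ·) c → c.Nonempty →
      ∃ lb ∈ {K | K ⊆ L ∧ IsClosed K ∧ ¬ P K}, ∀ s ∈ c, lb ⊆ s := by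
    rintro c hc hchain ⟨K₀, hK₀⟩
    refine ⟨⋂₀ c, ⟨(sInter_subset_of_mem hK₀).trans (hc hK₀).1,
      isClosed_sInter fun K hK => (hc hK).2.1, fun hPc => ?_⟩, fun s hs => sInter_subset_of_mem hs⟩
    obtain ⟨N, hN, hcN, hNP⟩ := hP _ ((sInter_subset_of_mem hK₀).trans (hc hK₀).1)
      (isClosed_sInter fun K hK => (hc hK).2.1) hPc
    have : Nonempty c := ⟨⟨K₀, hK₀⟩⟩
    have hdir : Directed (· ⊇ ·) fun K : c => (K : Set X) := by
      intro s t
      rcases hchain.total s.2 t.2 with h | h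
      · exact ⟨s, Subset.rfl, h⟩
      · exact ⟨t, h, Subset.rfl⟩
    obtain ⟨K, hKN⟩ := exists_subset_nhds_of_isCompact' hdir
      (fun K : c => hL.of_isClosed_subset (hc K.2).2.1 (hc K.2).1) (fun K : c => (hc K.2).2.1)
      (U := N) (fun x hx => hN.mem_nhds (hcN (by rwa [sInter_eq_iInter])))
    exact (hc K.2).2.2 (hNP _ (subset_inter (hc K.2).1 hKN) (hc K.2).2.1)
  obtain ⟨K, hKL, hK⟩ := zorn_superset_nonempty _ hzorn L ⟨Subset.rfl, hL.isClosed, hPL⟩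
  refine ⟨K, hKL, hK.prop.2.1, hK.prop.2.2, fun M hMK hM hne => ?_⟩
  by_contra hPM
  exact hne (hMK.antisymm (hK.le_of_le ⟨hMK.trans hKL, hM, hPM⟩ hMK))

/-- Tietze's theorem for functions that are continuous on a closed set. -/
theorem exists_continuous_eqOn {X : Type*} [TopologicalSpace X] [NormalSpace X] {K : Set X}
    (hK : IsClosed K) {u : X → ℂ} (hu : ContinuousOn u K) :
    ∃ g : X → ℂ, Continuous g ∧ EqOn g u K := by
  obtain ⟨g, hg⟩ := ContinuousMap.exists_restrict_eq hK
    ⟨K.domRestrict u, continuousOn_iff_continuous_domRestrict.1 hu⟩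
  exact ⟨g, g.continuous, fun x hx => DFunLike.congr_fun hg ⟨x, hx⟩⟩

/-- Continuous functions on two closed sets that agree on the intersection can be glued. -/
theorem exists_continuousOn_union_eqOn {A B : Set X} (hA : IsClosed A) (hB : IsClosed B)
    {u v : X → Y} (hu : ContinuousOn u A) (hv : ContinuousOn v B) (h : EqOn u v (A ∩ B)) :
    ∃ g : X → Y, ContinuousOn g (A ∪ B) ∧ EqOn g u A ∧ EqOn g v B := by
  classical
  have hgu : EqOn (A.piecewise u v) u A := piecewise_eqOn A u v
  have hgv : EqOn (A.piecewise u v) v B := by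
    intro x hx
    by_cases hxA : x ∈ A
    · simp [hxA, h ⟨hxA, hx⟩]
    · simp [hxA]
  exact ⟨A.piecewise u v, (hu.congr hgu).union_of_isClosed (hv.congr hgv) hA hB, hgu, hgv⟩

end Separation

section Logarithm

variable {X : Type*} [TopologicalSpace X]

/-- `h` has a continuous logarithm on `K`. -/
def HasLogOn (h : X → ℂ) (K : Set X) : Prop :=
  ∃ l : X → ℂ, ContinuousOn l K ∧ ∀ x ∈ K, Complex.exp (l x) = h x

theorem HasLogOn.exists_isOpen [NormalSpace X] {h : X → ℂ} {L K : Set X} (hh : ContinuousOn h L)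
    (hL : IsClosed L) (hK : IsClosed K) (hlog : HasLogOn h K) :
    ∃ N, IsOpen N ∧ K ⊆ N ∧ ∀ M ⊆ L ∩ N, HasLogOn h M := by
  obtain ⟨l, hl, hlh⟩ := hlog
  obtain ⟨g, hg, hgl⟩ := exists_continuous_eqOn hK hl
  have hq : ContinuousOn (fun x => Complex.exp (-g x) * h x) L := by fun_prop
  obtain ⟨N, hN, hNq⟩ := (continuousOn_iff'.1 hq) Complex.slitPlane Complex.isOpen_slitPlane
  have hmem : ∀ x ∈ L, x ∈ N → Complex.exp (-g x) * h x ∈ Complex.slitPlane := fun x hxL hxN =>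
    (hNq.symm.subset ⟨hxN, hxL⟩).1
  refine ⟨N ∪ Lᶜ, hN.union hL.isOpen_compl, fun x hx => ?_, fun M hM => ?_⟩
  · by_cases hxL : x ∈ L
    · refine Or.inl (hNq.subset ⟨?_, hxL⟩).1
      simp [hgl hx, ← hlh x hx, ← Complex.exp_add]
    · exact Or.inr hxL
  · have hMN : ∀ x ∈ M, x ∈ N := fun x hx => (hM hx).2.resolve_right fun h => h (hM hx).1
    refine ⟨fun x => g x + Complex.log (Complex.exp (-g x) * h x), ?_, fun x hx => ?_⟩
    · exact hg.continuousOn.add ((hq.mono fun x hx => (hM hx).1).clog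
        fun x hx => hmem x (hM hx).1 (hMN x hx))
    · rw [Complex.exp_add, Complex.exp_log
        (Complex.slitPlane_ne_zero (hmem x (hM hx).1 (hMN x hx))), ← mul_assoc, ← Complex.exp_add]
      simp

theorem HasLogOn.union {h : X → ℂ} {A B : Set X} (hA : IsClosed A) (hB : IsClosed B)
    (hlA : HasLogOn h A) (hlB : HasLogOn h B) (hAB : (A ∩ B).Subsingleton) :
    HasLogOn h (A ∪ B) := by
  obtain ⟨a, ha, hah⟩ := hlA
  obtain ⟨b, hb, hbh⟩ := hlB
  obtain ⟨k, hk, hk'⟩ : ∃ k : ℂ, Complex.exp k = 1 ∧ ∀ x ∈ A ∩ B, a x = b x + k := by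
    rcases hAB.eq_empty_or_singleton with h0 | ⟨m, hm⟩
    · exact ⟨0, by simp [h0]⟩
    · have hmem : m ∈ A ∩ B := hm ▸ mem_singleton m
      refine ⟨a m - b m, ?_, ?_⟩
      · rw [Complex.exp_sub, hah m hmem.1, ← hbh m hmem.2, div_self (Complex.exp_ne_zero _)]
      · simp [hm]
  obtain ⟨g, hg, hga, hgb⟩ := exists_continuousOn_union_eqOn hA hB ha (hb.add_const k) hk'
  refine ⟨g, hg, fun x hx => hx.elim (fun hx => ?_) fun hx => ?_⟩
  · rw [hga hx, hah x hx]
  · rw [hgb hx, Complex.exp_add, hbh x hx, hk, mul_one]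

theorem Set.Subsingleton.hasLogOn {h : X → ℂ} {K : Set X} (hK : K.Subsingleton)
    (h0 : ∀ x ∈ K, h x ≠ 0) : HasLogOn h K :=
  ⟨fun x => Complex.log (h x), hK.continuousOn _, fun x hx => Complex.exp_log (h0 x hx)⟩

/-- If a compact set admits an injective Darboux function to the line, then nonvanishing
continuous functions on it have continuous logarithms. -/
theorem hasLogOn_of_injOn_real [CompletelyNormalSpace X] [T2Space X] {L : Set X}
    (hL : IsCompact L) {φ : X → ℝ} (hinj : InjOn φ L)
    (hφ : ∀ M ⊆ L, IsPreconnected M → IsPreconnected (φ '' M))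
    {h : X → ℂ} (hh : ContinuousOn h L) (h0 : ∀ x ∈ L, h x ≠ 0) : HasLogOn h L := by
  by_contra hlog
  obtain ⟨M, hML, hM, hMlog, hmin⟩ := exists_minimal_isClosed_of_not hL (P := HasLogOn h)
    (fun K _ hK hlogK =>
      let ⟨N, hN, hKN, hlogN⟩ := hlogK.exists_isOpen hh hL.isClosed hK
      ⟨N, hN, hKN, fun M hM _ => hlogN M hM⟩) hlog
  suffices ∃ T : Set X, T.Subsingleton ∧ ¬ IsPreconnected (M \ T) by
    obtain ⟨T, hT, hTM⟩ := this
    obtain ⟨A, B, hA, hB, rfl, hAM, hBM, hAB⟩ :=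
      exists_isClosed_union_of_not_isPreconnected_diff hM hTM
    exact hMlog ((hmin A subset_union_left hA hAM).union hA hB
      (hmin B subset_union_right hB hBM) (hT.anti hAB))
  by_cases hMc : IsPreconnected M
  · obtain ⟨x, hx, y, hy, hxy⟩ : M.Nontrivial := by
      rw [← not_subsingleton_iff]
      exact fun h => hMlog (h.hasLogOn fun x hx => h0 x (hML hx))
    wlog hlt : φ x < φ y generalizing x y
    · exact this y hy x hx hxy.symm
        (lt_of_le_of_ne (not_lt.1 hlt) fun h => hxy (hinj (hML hy) (hML hx) h).symm)
    obtain ⟨m, hm, hφm⟩ : (φ x + φ y) / 2 ∈ φ '' M :=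
      (hφ M hML hMc).Icc_subset (mem_image_of_mem φ hx) (mem_image_of_mem φ hy)
        ⟨by linarith, by linarith⟩
    refine ⟨{m}, subsingleton_singleton, fun hc => ?_⟩
    have hne : ∀ z ∈ M, φ z ≠ φ m → z ∈ M \ {m} := fun z hz hzm => ⟨hz, fun h => hzm (h ▸ rfl)⟩
    refine not_isPreconnected_of_forall_ne (g := id) continuousOn_id (c := φ m) ?_
      (mem_image_of_mem φ (hne x hx (by linarith))) (mem_image_of_mem φ (hne y hy (by linarith)))
      (by simp only [id]; linarith) (by simp only [id]; linarith)
      (hφ _ (sdiff_subset.trans hML) hc)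
    rintro _ ⟨z, hz, rfl⟩ hzm
    exact hz.2 (hinj (hML hz.1) (hML hm) hzm)
  · exact ⟨∅, subsingleton_empty, by simpa using hMc⟩

theorem exists_continuous_exp_eq {E : Type*} [AddCommGroup E] [Module ℝ E] [TopologicalSpace E]
    [IsTopologicalAddGroup E] [ContinuousSMul ℝ E] [LocallyConvexSpace ℝ E]
    {h : E → ℂ} (hh : Continuous h) (h0 : ∀ x, h x ≠ 0) :
    ∃ l : E → ℂ, Continuous l ∧ ∀ x, Complex.exp (l x) = h x := by
  obtain ⟨l, ⟨-, hl⟩, -⟩ := Complex.isCoveringMapOn_exp.existsUnique_continuousMap_lifts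
    ⟨h, hh⟩ (a₀ := 0) (Complex.exp_log (h0 0)) h0
  exact ⟨l, l.continuous, fun x => congrFun hl x⟩

theorem not_hasLogOn_id_sphere : ¬ HasLogOn (id : ℂ → ℂ) (Metric.sphere 0 1) := by
  rintro ⟨l, hl, hexp⟩
  have hmem : ∀ t : ℝ, Complex.exp (t * Complex.I) ∈ Metric.sphere (0 : ℂ) 1 := fun t => by
    simp [Complex.norm_exp_ofReal_mul_I]
  have hcont : Continuous fun t : ℝ => l (Complex.exp (t * Complex.I)) - t * Complex.I :=
    (hl.comp_continuous (by fun_prop) hmem).sub (by fun_prop)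
  have hval : ∀ t : ℝ, ∃ n : ℤ,
      l (Complex.exp (t * Complex.I)) - t * Complex.I = n * (2 * Real.pi * Complex.I) := fun t =>
    Complex.exp_eq_one_iff.1 (by
      rw [Complex.exp_sub, hexp _ (hmem t), id, div_self (Complex.exp_ne_zero _)])
  choose n hn using hval
  have hpi : (2 * Real.pi * Complex.I : ℂ) ≠ 0 := Complex.two_pi_I_ne_zero
  have hncont : Continuous fun t => (n t : ℝ) := by
    have : (fun t => (n t : ℝ)) = fun t : ℝ =>
        ((l (Complex.exp (t * Complex.I)) - t * Complex.I) / (2 * Real.pi * Complex.I)).re := by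
      ext t
      rw [hn, mul_div_assoc, div_self hpi, mul_one]
      simp
    rw [this]
    exact Complex.continuous_re.comp (hcont.div_const _)
  have hn' : Continuous n := (Int.isClosedEmbedding_coe_real.isEmbedding.continuous_iff).2 hncont
  have heq : n 0 = n (2 * Real.pi) := PreconnectedSpace.constant inferInstance hn'
  have h₁ := hn 0
  have h₂ := hn (2 * Real.pi)
  rw [← heq, ← h₁] at h₂
  push_cast at h₂
  rw [Complex.exp_two_pi_mul_I] at h₂
  simp at h₂

end Logarithm

/-- A bounded neighbourhood of `0` in the plane is not separated from infinity by a closed set on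
which the identity has a continuous logarithm. -/
theorem not_hasLogOn_id_of_frontier_subset {U K : Set ℂ} (hU : IsOpen U)
    (hUb : Bornology.IsBounded U) (h0 : (0 : ℂ) ∈ U) (hK : IsClosed K) (hUK : frontier U ⊆ K) :
    ¬ HasLogOn (id : ℂ → ℂ) K := by
  rintro ⟨l, hl, hexp⟩
  obtain ⟨g, hg, hgl⟩ := exists_continuous_eqOn hK hl
  obtain ⟨H, hH, hHU, hHc⟩ := exists_continuousOn_union_eqOn (isClosed_closure (s := U))
    hU.isClosed_compl (u := fun x => Complex.exp (g x)) (v := id) (by fun_prop) (by fun_prop)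
    (fun x hx => by
      have hxK : x ∈ K := hUK (by rwa [hU.frontier_eq])
      simp only [hgl hxK, hexp x hxK])
  have huniv : closure U ∪ Uᶜ = univ :=
    eq_univ_of_forall fun x => (em (x ∈ U)).imp (fun h => subset_closure h) id
  rw [huniv, continuousOn_univ] at hH
  have hH0 : ∀ x, H x ≠ 0 := fun x => by
    by_cases hx : x ∈ U
    · rw [hHU (subset_closure hx)]
      exact Complex.exp_ne_zero _
    · rw [hHc hx]
      exact fun h => hx ((show x = 0 from h) ▸ h0)
  obtain ⟨R, hR, hUR⟩ := hUb.subset_ball_lt 0 0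
  obtain ⟨L, hL, hLH⟩ := exists_continuous_exp_eq hH hH0
  refine not_hasLogOn_id_sphere ⟨fun z => L (R * z) - Real.log R, by fun_prop, fun z hz => ?_⟩
  have hzU : (R * z : ℂ) ∉ U := fun h => by
    have h' := hUR h
    rw [mem_sphere_zero_iff_norm] at hz
    rw [mem_ball_zero_iff, norm_mul, hz, mul_one, Complex.norm_real, Real.norm_eq_abs] at h'
    exact absurd (le_abs_self R) (not_le.2 h')
  have hR' : (R : ℂ) ≠ 0 := by exact_mod_cast hR.ne'
  rw [Complex.exp_sub, hLH, hHc hzU, ← Complex.ofReal_exp, Real.exp_log hR]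
  simp only [id]
  field_simp

section Spinor

open ComplexConjugate

/-- The pair `(a, b)` lies in the complex line of `ℂ²` that the Hopf fibration assigns to the
direction of the vector `x` of `ℝ³`. -/
def IsSpinor (x : EuclideanSpace ℝ (Fin 3)) (a b : ℂ) : Prop :=
  ((‖x‖ - x 2 : ℝ) : ℂ) * a = conj (⟨x 0, x 1⟩ : ℂ) * b ∧
    (⟨x 0, x 1⟩ : ℂ) * a = ((‖x‖ + x 2 : ℝ) : ℂ) * b

/-- The direction field `d` lifts through the Hopf fibration on `K`. -/
def HasSpinorOn {X : Type*} [TopologicalSpace X] (d : X → EuclideanSpace ℝ (Fin 3))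
    (K : Set X) : Prop :=
  ∃ a b : X → ℂ, ContinuousOn a K ∧ ContinuousOn b K ∧
    ∀ x ∈ K, (a x ≠ 0 ∨ b x ≠ 0) ∧ IsSpinor (d x) (a x) (b x)

theorem mk_mul_conj_eq (x : EuclideanSpace ℝ (Fin 3)) :
    (⟨x 0, x 1⟩ : ℂ) * conj (⟨x 0, x 1⟩ : ℂ) =
      ((‖x‖ - x 2 : ℝ) : ℂ) * ((‖x‖ + x 2 : ℝ) : ℂ) := by
  rw [Complex.mul_conj, ← Complex.ofReal_mul, Complex.normSq_mk]
  have := EuclideanSpace.real_norm_sq_eq x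
  rw [Fin.sum_univ_three] at this
  congr 1
  linarith

theorem continuous_mk_coords {X : Type*} [TopologicalSpace X] {s : Set X}
    {d : X → EuclideanSpace ℝ (Fin 3)} (hd : ContinuousOn d s) :
    ContinuousOn (fun x => (⟨d x 0, d x 1⟩ : ℂ)) s := by
  have : (fun x => (⟨d x 0, d x 1⟩ : ℂ)) = fun x => (d x 0 : ℂ) + d x 1 * Complex.I := by
    ext x
    exact Complex.mk_eq_add_mul_I _ _
  rw [this]
  fun_prop

theorem isSpinor_project (x : EuclideanSpace ℝ (Fin 3)) (u w : ℂ) :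
    IsSpinor x (((‖x‖ + x 2 : ℝ) : ℂ) * u + conj (⟨x 0, x 1⟩ : ℂ) * w)
      ((⟨x 0, x 1⟩ : ℂ) * u + ((‖x‖ - x 2 : ℝ) : ℂ) * w) := by
  have := mk_mul_conj_eq x
  constructor
  · linear_combination (-u) * this
  · linear_combination w * this

theorem IsSpinor.project_eq {x : EuclideanSpace ℝ (Fin 3)} {u w : ℂ} (h : IsSpinor x u w) :
    ((‖x‖ + x 2 : ℝ) : ℂ) * u + conj (⟨x 0, x 1⟩ : ℂ) * w = 2 * ‖x‖ * u ∧
      (⟨x 0, x 1⟩ : ℂ) * u + ((‖x‖ - x 2 : ℝ) : ℂ) * w = 2 * ‖x‖ * w := by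
  obtain ⟨h₁, h₂⟩ := h
  push_cast at *
  constructor
  · linear_combination -h₁
  · linear_combination h₂

theorem IsSpinor.mul_eq_mul {x : EuclideanSpace ℝ (Fin 3)} (hx : x ≠ 0) {a b a' b' : ℂ}
    (h : IsSpinor x a b) (h' : IsSpinor x a' b') : a * b' = b * a' := by
  obtain ⟨h₁, h₂⟩ := h
  obtain ⟨h₁', h₂'⟩ := h'
  have hn : (2 * ‖x‖ : ℂ) ≠ 0 := by simpa using hx
  push_cast at *
  refine mul_left_cancel₀ hn ?_
  linear_combination b' * h₁ - b * h₁' + a' * h₂ - a * h₂'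

theorem IsSpinor.smul {x : EuclideanSpace ℝ (Fin 3)} {a b : ℂ} (h : IsSpinor x a b) (k : ℂ) :
    IsSpinor x (k * a) (k * b) := by
  obtain ⟨h₁, h₂⟩ := h
  exact ⟨by linear_combination k * h₁, by linear_combination k * h₂⟩

theorem normSq_add_normSq_ne_zero {a b : ℂ} (h : a ≠ 0 ∨ b ≠ 0) :
    a * conj a + b * conj b ≠ 0 := by
  rw [Complex.mul_conj, Complex.mul_conj, ← Complex.ofReal_add, Complex.ofReal_ne_zero]
  rcases h with h | h
  · have := Complex.normSq_pos.2 h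
    have := Complex.normSq_nonneg b
    positivity
  · have := Complex.normSq_pos.2 h
    have := Complex.normSq_nonneg a
    positivity

variable {X : Type*} [TopologicalSpace X]

theorem HasSpinorOn.exists_isOpen [NormalSpace X] {d : X → EuclideanSpace ℝ (Fin 3)}
    {L K : Set X} (hd : ContinuousOn d L) (hd0 : ∀ x ∈ L, d x ≠ 0) (hL : IsClosed L)
    (hK : IsClosed K) (h : HasSpinorOn d K) :
    ∃ N, IsOpen N ∧ K ⊆ N ∧ ∀ M ⊆ L ∩ N, HasSpinorOn d M := by
  obtain ⟨a, b, ha, hb, hab⟩ := h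
  obtain ⟨u, hu, hua⟩ := exists_continuous_eqOn hK ha
  obtain ⟨w, hw, hwb⟩ := exists_continuous_eqOn hK hb
  have hz := continuous_mk_coords hd
  set A : X → ℂ := fun x =>
    ((‖d x‖ + d x 2 : ℝ) : ℂ) * u x + conj (⟨d x 0, d x 1⟩ : ℂ) * w x with hAdef
  set B : X → ℂ := fun x =>
    (⟨d x 0, d x 1⟩ : ℂ) * u x + ((‖d x‖ - d x 2 : ℝ) : ℂ) * w x with hBdef
  have hA : ContinuousOn A L :=
    (ContinuousOn.mul (by fun_prop) (by fun_prop)).add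
      ((Complex.continuous_conj.comp_continuousOn hz).mul (by fun_prop))
  have hB : ContinuousOn B L :=
    (hz.mul (by fun_prop)).add (ContinuousOn.mul (by fun_prop) (by fun_prop))
  obtain ⟨N, hN, hNq⟩ := (continuousOn_iff'.1 (hA.prodMk hB)) {0}ᶜ isOpen_compl_singleton
  refine ⟨N ∪ Lᶜ, hN.union hL.isOpen_compl, fun x hx => ?_, fun M hM => ?_⟩
  · by_cases hxL : x ∈ L
    · refine Or.inl (hNq.subset ⟨?_, hxL⟩).1
      obtain ⟨hne, hs⟩ := hab x hx
      have hn : (2 * ‖d x‖ : ℂ) ≠ 0 := by simpa using hd0 x hxL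
      have hproj := hs.project_eq
      rw [← hua hx, ← hwb hx] at hproj hne
      intro h0
      have hA0 : A x = 0 := congrArg Prod.fst h0
      have hB0 : B x = 0 := congrArg Prod.snd h0
      simp only [hAdef, hproj.1] at hA0
      simp only [hBdef, hproj.2] at hB0
      rcases hne with hne | hne
      · exact mul_ne_zero hn hne hA0
      · exact mul_ne_zero hn hne hB0
    · exact Or.inr hxL
  · have hMN : ∀ x ∈ M, x ∈ N := fun x hx => (hM hx).2.resolve_right fun h => h (hM hx).1
    refine ⟨A, B, hA.mono fun x hx => (hM hx).1, hB.mono fun x hx => (hM hx).1, fun x hx =>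
      ⟨?_, isSpinor_project _ _ _⟩⟩
    have := (hNq.symm.subset ⟨hMN x hx, (hM hx).1⟩).1
    by_contra! h0
    exact this (Prod.ext h0.1 h0.2)

/-- Lifts through the Hopf fibration on two closed sets can be glued when nonvanishing functions on
the intersection have logarithms. -/
theorem HasSpinorOn.union [NormalSpace X] {d : X → EuclideanSpace ℝ (Fin 3)} {A B : Set X}
    (hd0 : ∀ x ∈ A ∩ B, d x ≠ 0) (hA : IsClosed A) (hB : IsClosed B)
    (hsA : HasSpinorOn d A) (hsB : HasSpinorOn d B)
    (hlog : ∀ h : X → ℂ, ContinuousOn h (A ∩ B) → (∀ x ∈ A ∩ B, h x ≠ 0) → HasLogOn h (A ∩ B)) :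
    HasSpinorOn d (A ∪ B) := by
  obtain ⟨a, b, ha, hb, hab⟩ := hsA
  obtain ⟨a', b', ha', hb', hab'⟩ := hsB
  have hsub : A ∩ B ⊆ A := inter_subset_left
  have hsub' : A ∩ B ⊆ B := inter_subset_right
  have hne' : ∀ x ∈ A ∩ B, a' x * conj (a' x) + b' x * conj (b' x) ≠ 0 := fun x hx =>
    normSq_add_normSq_ne_zero (hab' x hx.2).1
  set h : X → ℂ := fun x => (a x * conj (a' x) + b x * conj (b' x)) /
    (a' x * conj (a' x) + b' x * conj (b' x)) with hh
  have hcont : ContinuousOn h (A ∩ B) := by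
    have h1 := Complex.continuous_conj.comp_continuousOn (ha'.mono hsub')
    have h2 := Complex.continuous_conj.comp_continuousOn (hb'.mono hsub')
    exact ContinuousOn.div (((ha.mono hsub).mul h1).add ((hb.mono hsub).mul h2))
      (((ha'.mono hsub').mul h1).add ((hb'.mono hsub').mul h2)) hne'
  have hmul : ∀ x ∈ A ∩ B, a x = h x * a' x ∧ b x = h x * b' x := fun x hx => by
    have hprop := (hab x hx.1).2.mul_eq_mul (hd0 x hx) (hab' x hx.2).2
    have := hne' x hx
    simp only [hh]
    constructor
    · rw [div_mul_eq_mul_div, eq_div_iff this]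
      linear_combination conj (b' x) * hprop
    · rw [div_mul_eq_mul_div, eq_div_iff this]
      linear_combination -conj (a' x) * hprop
  have h0 : ∀ x ∈ A ∩ B, h x ≠ 0 := fun x hx hx0 => by
    have := hmul x hx
    rw [hx0, zero_mul, zero_mul] at this
    exact (hab x hx.1).1.elim (fun h => h this.1) fun h => h this.2
  obtain ⟨l, hl, hlh⟩ := hlog h hcont h0
  obtain ⟨g, hg, hgl⟩ := exists_continuous_eqOn (hA.inter hB) hl
  have hgh : ∀ x ∈ A ∩ B, Complex.exp (g x) = h x := fun x hx => by rw [hgl hx, hlh x hx]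
  obtain ⟨s, hs, hsa, hsa'⟩ := exists_continuousOn_union_eqOn hA hB ha
    (v := fun x => Complex.exp (g x) * a' x) (by fun_prop)
    (fun x hx => by simp only [hgh x hx, (hmul x hx).1])
  obtain ⟨t, ht, htb, htb'⟩ := exists_continuousOn_union_eqOn hA hB hb
    (v := fun x => Complex.exp (g x) * b' x) (by fun_prop)
    (fun x hx => by simp only [hgh x hx, (hmul x hx).2])
  refine ⟨s, t, hs, ht, fun x hx => hx.elim (fun hx => ?_) fun hx => ?_⟩
  · rw [hsa hx, htb hx]
    exact hab x hx
  · rw [hsa' hx, htb' hx]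
    exact ⟨(hab' x hx).1.imp (mul_ne_zero (Complex.exp_ne_zero _))
      (mul_ne_zero (Complex.exp_ne_zero _)), (hab' x hx).2.smul _⟩

theorem Set.Subsingleton.hasSpinorOn {d : X → EuclideanSpace ℝ (Fin 3)} {K : Set X}
    (hK : K.Subsingleton) : HasSpinorOn d K := by
  have : ∀ x : EuclideanSpace ℝ (Fin 3), ∃ p : ℂ × ℂ, (p.1 ≠ 0 ∨ p.2 ≠ 0) ∧
      IsSpinor x p.1 p.2 := fun x => by
    by_cases hx : x = 0
    · exact ⟨(1, 0), by simp, by simp [hx, IsSpinor, Complex.ext_iff]⟩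
    by_cases h : ((‖x‖ + x 2 : ℝ) : ℂ) = 0
    · refine ⟨(_, _), Or.inr ?_, isSpinor_project x 0 1⟩
      have hx' : ‖x‖ ≠ 0 := by simpa using hx
      rw [Complex.ofReal_eq_zero] at h
      have : x 2 = -‖x‖ := by linarith
      simpa [this] using hx
    · refine ⟨(_, _), Or.inl ?_, isSpinor_project x 1 0⟩
      simpa using h
  choose p hp using this
  exact ⟨fun x => (p (d x)).1, fun x => (p (d x)).2, hK.continuousOn _, hK.continuousOn _,
    fun x _ => hp (d x)⟩

/-- The Hopf fibration has no section over a round sphere. -/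
theorem not_hasSpinorOn_id_sphere {R : ℝ} (hR : 0 < R) :
    ¬ HasSpinorOn (id : EuclideanSpace ℝ (Fin 3) → EuclideanSpace ℝ (Fin 3))
      (Metric.sphere 0 R) := by
  rintro ⟨a, b, ha, hb, hab⟩
  let pt : ℝ → ℂ → EuclideanSpace ℝ (Fin 3) := fun s z =>
    !₂[R * (2 * z.re) / (1 + Complex.normSq z), R * (2 * z.im) / (1 + Complex.normSq z),
      s * (R * (1 - Complex.normSq z)) / (1 + Complex.normSq z)]
  have hden : ∀ z : ℂ, 1 + Complex.normSq z ≠ 0 := fun z => by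
    have := Complex.normSq_nonneg z
    positivity
  have hcont : ∀ s, Continuous (pt s) := fun s => by
    have hn : Continuous fun z : ℂ => 1 + Complex.normSq z := by
      have := Complex.continuous_normSq
      fun_prop
    have hn' := Complex.continuous_normSq
    refine (PiLp.continuous_toLp 2 _).comp (continuous_pi fun i => ?_)
    fin_cases i
    · exact Continuous.div (by fun_prop) hn hden
    · exact Continuous.div (by fun_prop) hn hden
    · exact Continuous.div (by fun_prop) hn hden
  have hnorm : ∀ s z, s ^ 2 = 1 → ‖pt s z‖ = R := fun s z hs => by
    rw [← sq_eq_sq₀ (norm_nonneg _) hR.le, EuclideanSpace.real_norm_sq_eq, Fin.sum_univ_three]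
    have := hden z
    simp only [pt, Matrix.cons_val_zero, Matrix.cons_val_one, Matrix.cons_val]
    field_simp
    rw [Complex.normSq_apply, hs]
    ring
  have hmem : ∀ s z, s ^ 2 = 1 → pt s z ∈ Metric.sphere 0 R := fun s z hs => by
    simp [hnorm s z hs]
  have hsum : ∀ z : ℂ, R + R * (1 - Complex.normSq z) / (1 + Complex.normSq z) ≠ 0 := fun z => by
    have h := hden z
    have : R + R * (1 - Complex.normSq z) / (1 + Complex.normSq z) =
        2 * R / (1 + Complex.normSq z) := by
      field_simp
      ring
    rw [this]
    positivity
  have ha0 : ∀ z, a (pt 1 z) ≠ 0 := fun z h => by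
    obtain ⟨hne, -, h₂⟩ := hab _ (hmem 1 z (by norm_num))
    have hb0 : b (pt 1 z) ≠ 0 := hne.resolve_left fun hn => hn h
    rw [h, mul_zero, eq_comm, mul_eq_zero, Complex.ofReal_eq_zero] at h₂
    have h₃ := h₂.resolve_right hb0
    rw [id, hnorm 1 z (by norm_num)] at h₃
    exact hsum z (by simpa [pt] using h₃)
  have hb0 : ∀ z, b (pt (-1) z) ≠ 0 := fun z h => by
    obtain ⟨hne, h₁, -⟩ := hab _ (hmem (-1) z (by norm_num))
    have ha0 : a (pt (-1) z) ≠ 0 := hne.resolve_right fun hn => hn h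
    rw [h, mul_zero, mul_eq_zero, Complex.ofReal_eq_zero] at h₁
    have h₃ := h₁.resolve_right ha0
    rw [id, hnorm (-1) z (by norm_num)] at h₃
    exact hsum z (by simpa [pt, neg_div] using h₃)
  obtain ⟨k, hk, hka⟩ := exists_continuous_exp_eq
    (ha.comp_continuous (hcont 1) fun z => hmem 1 z (by norm_num)) ha0
  obtain ⟨l, hl, hlb⟩ := exists_continuous_exp_eq
    (hb.comp_continuous (hcont (-1)) fun z => hmem (-1) z (by norm_num)) hb0
  refine not_hasLogOn_id_sphere ⟨fun z => l z - k z, by fun_prop, fun z hz => ?_⟩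
  have hz1 : Complex.normSq z = 1 := by
    rw [Complex.normSq_eq_norm_sq, mem_sphere_zero_iff_norm.1 hz, one_pow]
  have hpt : pt (-1) z = pt 1 z := by simp [pt, hz1]
  obtain ⟨-, -, h₂⟩ := hab _ (hmem 1 z (by norm_num))
  have h2 : (⟨pt 1 z 0, pt 1 z 1⟩ : ℂ) = R * z := by
    apply Complex.ext <;> simp [pt, hz1] <;> ring
  have h3 : ‖pt 1 z‖ + pt 1 z 2 = R := by
    rw [hnorm 1 z (by norm_num)]
    simp [pt, hz1]
  simp only [id, h2, h3] at h₂
  have hR' : (R : ℂ) ≠ 0 := by exact_mod_cast hR.ne'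
  rw [Complex.exp_sub, hka, hlb, Function.comp_apply, Function.comp_apply, hpt,
    div_eq_iff (ha0 z)]
  refine mul_left_cancel₀ hR' ?_
  simp only [id]
  linear_combination -h₂

end Spinor

/-- A continuous field of projections over a ball has a nonvanishing continuous field of fixed
vectors as soon as it has a nonzero fixed vector at the centre. -/
theorem exists_continuousOn_closedBall_fixed {E V : Type*} [NormedAddCommGroup E]
    [NormedSpace ℝ E] [ProperSpace E] [NormedAddCommGroup V] [NormedSpace ℂ V]
    {T : E → V →L[ℂ] V} (hT : Continuous T) (hidem : ∀ x v, T x (T x v) = T x v)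
    {v₀ : V} (hv₀ : v₀ ≠ 0) (hfix : T 0 v₀ = v₀) {R : ℝ} (hR : 0 < R) :
    ∃ v : E → V, ContinuousOn v (Metric.closedBall 0 R) ∧
      ∀ x ∈ Metric.closedBall (0 : E) R, v x ≠ 0 ∧ T x (v x) = v x := by
  have hunif := (isCompact_closedBall (0 : E) R).uniformContinuousOn_of_continuous hT.continuousOn
  obtain ⟨δ, hδ, hδT⟩ := Metric.uniformContinuousOn_iff.1 hunif 1 one_pos
  obtain ⟨N, hN⟩ := exists_nat_gt (R / δ)
  have hN0 : (0 : ℝ) < N := lt_of_le_of_lt (by positivity) hN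
  suffices ∀ j : ℕ, j ≤ N → ∃ v : E → V, ContinuousOn v (Metric.closedBall 0 R) ∧
      ∀ x ∈ Metric.closedBall (0 : E) R, v x ≠ 0 ∧ T ((j / N : ℝ) • x) (v x) = v x by
    simpa [div_self hN0.ne'] using this N le_rfl
  intro j
  induction j with
  | zero => exact fun _ => ⟨fun _ => v₀, continuousOn_const, fun x _ => by simp [hv₀, hfix]⟩
  | succ j ih =>
    intro hj
    obtain ⟨v, hv, hvT⟩ := ih (by omega)
    have hjN : (j + 1 : ℝ) / N ≤ 1 := by
      rw [div_le_one hN0]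
      exact_mod_cast hj
    refine ⟨fun x => T (((j + 1 : ℕ) / N : ℝ) • x) (v x), ?_, fun x hx => ⟨fun h0 => ?_,
      hidem _ _⟩⟩
    · exact ContinuousOn.clm_apply (hT.comp (continuous_const_smul _)).continuousOn hv
    · obtain ⟨hne, hvx⟩ := hvT x hx
      have hxR : ‖x‖ ≤ R := by simpa using hx
      have hmem : ∀ t : ℝ, 0 ≤ t → t ≤ 1 → t • x ∈ Metric.closedBall (0 : E) R := fun t ht ht1 => by
        rw [mem_closedBall_zero_iff, norm_smul, Real.norm_of_nonneg ht]
        nlinarith [norm_nonneg x]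
      have hle : (j / N : ℝ) ≤ (j + 1) / N := by gcongr; linarith
      have hd : dist (((j : ℝ) / N) • x) ((((j : ℝ) + 1) / N) • x) < δ := by
        rw [dist_eq_norm, ← sub_smul, norm_smul, ← sub_div, sub_add_cancel_left, norm_div, norm_neg,
          norm_one, Real.norm_of_nonneg hN0.le, one_div, inv_mul_eq_div, div_lt_iff₀ hN0]
        rw [div_lt_iff₀ hδ] at hN
        linarith
      have := hδT _ (hmem _ (by positivity) (hle.trans hjN)) _ (hmem _ (by positivity) hjN) hd
      rw [dist_eq_norm] at this
      push_cast at h0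
      have hv0 : 0 < ‖v x‖ := norm_pos_iff.2 hne
      have hop := (T (((j : ℝ) / N) • x) - T ((((j : ℝ) + 1) / N) • x)).le_opNorm (v x)
      rw [_root_.sub_apply, hvx, h0, sub_zero] at hop
      nlinarith

section SpinorMatrix

open ComplexConjugate Matrix
open scoped ComplexOrder

/-- The projection of `ℂ³` onto the line of spinors of `x` in `ℂ²`. -/
noncomputable def spinorMatrix (x : EuclideanSpace ℝ (Fin 3)) : Matrix (Fin 3) (Fin 3) ℂ :=
  (2 * ‖x‖ : ℂ)⁻¹ • !![((‖x‖ + x 2 : ℝ) : ℂ), conj (⟨x 0, x 1⟩ : ℂ), 0;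
    (⟨x 0, x 1⟩ : ℂ), ((‖x‖ - x 2 : ℝ) : ℂ), 0; 0, 0, 0]

/-- The orthogonal projection of `ℂ³` onto the line spanned by `w`. -/
noncomputable def lineMatrix (w : Fin 3 → ℂ) : Matrix (Fin 3) (Fin 3) ℂ :=
  (w ⬝ᵥ star w)⁻¹ • vecMulVec w (star w)

theorem dotProduct_star_self_ne_zero {w : Fin 3 → ℂ} (hw : w ≠ 0) : w ⬝ᵥ star w ≠ 0 :=
  fun h => hw (dotProduct_self_star_eq_zero.1 h)

theorem spinorMatrix_mul_self {x : EuclideanSpace ℝ (Fin 3)} (hx : x ≠ 0) :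
    spinorMatrix x * spinorMatrix x = spinorMatrix x := by
  have hn : (‖x‖ : ℂ) ≠ 0 := by simpa using hx
  have h := mk_mul_conj_eq x
  push_cast at h
  ext i j
  fin_cases i <;> fin_cases j <;>
    simp [spinorMatrix, Matrix.mul_apply, Fin.sum_univ_three] <;> field_simp <;>
    first | ring1 | linear_combination h

theorem lineMatrix_mul_self {w : Fin 3 → ℂ} (hw : w ≠ 0) :
    lineMatrix w * lineMatrix w = lineMatrix w := by
  have := dotProduct_star_self_ne_zero hw
  rw [lineMatrix, smul_mul_smul_comm, vecMulVec_mul_vecMulVec, dotProduct_comm (star w) w]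
  ext i j
  simp [vecMulVec_apply]
  field_simp

theorem lineMatrix_mulVec_self {w : Fin 3 → ℂ} (hw : w ≠ 0) : lineMatrix w *ᵥ w = w := by
  have := dotProduct_star_self_ne_zero hw
  rw [lineMatrix, smul_mulVec, vecMulVec_mulVec, dotProduct_comm (star w) w]
  ext i
  simp
  field_simp

theorem lineMatrix_eq_spinorMatrix {x : EuclideanSpace ℝ (Fin 3)} (hx : x ≠ 0) {a b : ℂ}
    (hne : a ≠ 0 ∨ b ≠ 0) (h : IsSpinor x a b) : lineMatrix ![a, b, 0] = spinorMatrix x := by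
  have hn : (‖x‖ : ℂ) ≠ 0 := by simpa using hx
  have hab := normSq_add_normSq_ne_zero hne
  obtain ⟨h₁, h₂⟩ := h
  have h₁' := congrArg conj h₁
  have h₂' := congrArg conj h₂
  simp only [map_mul, Complex.conj_conj, Complex.conj_ofReal] at h₁' h₂'
  push_cast at h₁ h₂ h₁' h₂'
  have hdot : (![a, b, 0] : Fin 3 → ℂ) ⬝ᵥ star ![a, b, 0] = a * conj a + b * conj b := by
    simp [dotProduct, Fin.sum_univ_three]
  ext i j
  rw [lineMatrix, hdot, Matrix.smul_apply, vecMulVec_apply]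
  fin_cases i <;> fin_cases j <;> simp [spinorMatrix] <;> field_simp
  · linear_combination conj a * h₁ + b * h₂'
  · linear_combination conj b * h₁ - a * h₂'
  · linear_combination b * h₁' - conj a * h₂
  · linear_combination -conj a * h₁ - b * h₂'

theorem isSpinor_of_spinorMatrix_mulVec {x : EuclideanSpace ℝ (Fin 3)} (hx : x ≠ 0)
    {v : Fin 3 → ℂ} (hv : v ≠ 0) (h : spinorMatrix x *ᵥ v = v) :
    (v 0 ≠ 0 ∨ v 1 ≠ 0) ∧ IsSpinor x (v 0) (v 1) := by
  have hn : (‖x‖ : ℂ) ≠ 0 := by simpa using hx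
  have h0 := congrFun h 0
  have h1 := congrFun h 1
  have h2 := congrFun h 2
  simp [spinorMatrix, mulVec, dotProduct, Fin.sum_univ_three] at h0 h1 h2
  field_simp at h0 h1
  refine ⟨?_, ?_, ?_⟩
  · by_contra! hz
    refine hv (funext fun i => ?_)
    fin_cases i
    · exact hz.1
    · exact hz.2
    · exact h2.symm
  · push_cast
    linear_combination -h0
  · push_cast
    linear_combination h1

/-- A bounded neighbourhood of `0` in space is not separated from infinity by a closed set on
which the direction field lifts through the Hopf fibration. -/
theorem not_hasSpinorOn_id_of_frontier_subset {U K : Set (EuclideanSpace ℝ (Fin 3))}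
    (hU : IsOpen U) (hUb : Bornology.IsBounded U) (h0 : 0 ∈ U) (hK : IsClosed K)
    (hUK : frontier U ⊆ K) :
    ¬ HasSpinorOn (id : EuclideanSpace ℝ (Fin 3) → EuclideanSpace ℝ (Fin 3)) K := by
  rintro ⟨a, b, ha, hb, hab⟩
  obtain ⟨R, hR, hUR⟩ := hUb.subset_ball_lt 0 0
  have hout : ∀ x ∈ Metric.sphere (0 : EuclideanSpace ℝ (Fin 3)) R, x ∈ Uᶜ := fun x hx hxU => by
    have := hUR hxU
    rw [mem_ball_zero_iff, mem_sphere_zero_iff_norm.1 hx] at this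
    exact this.false
  have hcompl : (Uᶜ).Nonempty := by
    obtain ⟨x, hx⟩ := (NormedSpace.sphere_nonempty (x := (0 : EuclideanSpace ℝ (Fin 3)))).2 hR.le
    exact ⟨x, hout x hx⟩
  obtain ⟨s, hs, hsa⟩ := exists_continuous_eqOn hK ha
  obtain ⟨t, ht, htb⟩ := exists_continuous_eqOn hK hb
  have hne : ∀ x ∈ Uᶜ, x ≠ 0 := fun x hx h => hx (h ▸ h0)
  let w : EuclideanSpace ℝ (Fin 3) → Fin 3 → ℂ := fun x =>
    ![s x, t x, (Metric.infDist x Uᶜ : ℝ)]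
  have hw : Continuous w := by
    refine continuous_pi fun i => ?_
    fin_cases i
    · exact hs
    · exact ht
    · exact Complex.continuous_ofReal.comp (Metric.continuous_infDist_pt _)
  have hfr : ∀ x ∈ closure U ∩ Uᶜ, w x = ![a x, b x, 0] ∧ x ∈ K := fun x hx => by
    have hxK : x ∈ K := hUK (by rwa [hU.frontier_eq])
    refine ⟨?_, hxK⟩
    simp only [w, hsa hxK, htb hxK, Metric.infDist_zero_of_mem hx.2, Complex.ofReal_zero]
  have hw0 : ∀ x ∈ closure U, w x ≠ 0 := fun x hx h => by
    by_cases hxU : x ∈ U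
    · have h2 : ((Metric.infDist x Uᶜ : ℝ) : ℂ) = 0 := congrFun h 2
      exact ((hU.isClosed_compl.notMem_iff_infDist_pos hcompl).1 (fun h => h hxU)).ne'
        (Complex.ofReal_eq_zero.1 h2)
    · obtain ⟨hwx, hxK⟩ := hfr x ⟨hx, hxU⟩
      rw [hwx] at h
      exact (hab x hxK).1.elim (fun hn => hn (congrFun h 0)) fun hn => hn (congrFun h 1)
  have hline : ContinuousOn (fun x => lineMatrix (w x)) (closure U) := by
    have hdot : Continuous fun x => w x ⬝ᵥ star (w x) := by fun_prop
    have hvec : Continuous fun x => vecMulVec (w x) (star (w x)) := by fun_prop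
    exact (hdot.continuousOn.inv₀ fun x hx => dotProduct_star_self_ne_zero (hw0 x hx)).smul
      hvec.continuousOn
  have hspin : ContinuousOn spinorMatrix Uᶜ := by
    have hz := continuous_mk_coords (continuousOn_id (s := (univ : Set (EuclideanSpace ℝ (Fin 3)))))
    rw [continuousOn_univ] at hz
    have hnorm : Continuous fun x : EuclideanSpace ℝ (Fin 3) => (2 * ‖x‖ : ℂ) := by fun_prop
    refine (hnorm.continuousOn.inv₀ fun x hx => ?_).smul (Continuous.continuousOn ?_)
    · simpa using hne x hx
    · refine continuous_matrix fun i j => ?_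
      fin_cases i <;> fin_cases j <;> simp <;>
        first | exact hz | exact Complex.continuous_conj.comp hz | fun_prop
  have heq : EqOn (fun x => lineMatrix (w x)) spinorMatrix (closure U ∩ Uᶜ) := by
    intro x hx
    obtain ⟨hwx, hxK⟩ := hfr x hx
    simp only [hwx]
    exact lineMatrix_eq_spinorMatrix (hne x hx.2) (hab x hxK).1 (hab x hxK).2
  obtain ⟨M, hM, hMU, hMc⟩ := exists_continuousOn_union_eqOn (isClosed_closure (s := U))
    hU.isClosed_compl hline hspin heq
  have huniv : closure U ∪ Uᶜ = univ :=
    eq_univ_of_forall fun x => (em (x ∈ U)).imp (fun h => subset_closure h) id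
  rw [huniv, continuousOn_univ] at hM
  have hidem : ∀ x, M x * M x = M x := fun x => by
    by_cases hx : x ∈ U
    · rw [hMU (subset_closure hx)]
      exact lineMatrix_mul_self (hw0 x (subset_closure hx))
    · rw [hMc hx]
      exact spinorMatrix_mul_self (hne x hx)
  let Φ : Matrix (Fin 3) (Fin 3) ℂ →ₗ[ℂ] ((Fin 3 → ℂ) →L[ℂ] (Fin 3 → ℂ)) :=
    LinearMap.toContinuousLinearMap.toLinearMap ∘ₗ (Matrix.toLin' (R := ℂ)).toLinearMap
  have hΦ : ∀ A v, Φ A v = A *ᵥ v := fun A v => rfl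
  have hcl := subset_closure h0
  obtain ⟨v, hv, hvM⟩ := exists_continuousOn_closedBall_fixed (T := fun x => Φ (M x))
    (Φ.continuous_of_finiteDimensional.comp hM)
    (fun x v => by rw [hΦ, hΦ, mulVec_mulVec, hidem])
    (hw0 0 hcl) (by rw [hΦ, hMU hcl]; exact lineMatrix_mulVec_self (hw0 0 hcl)) hR
  have hsub := Metric.sphere_subset_closedBall (x := (0 : EuclideanSpace ℝ (Fin 3))) (ε := R)
  refine not_hasSpinorOn_id_sphere hR ⟨fun x => v x 0, fun x => v x 1,
    (continuous_apply 0).comp_continuousOn (hv.mono hsub),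
    (continuous_apply 1).comp_continuousOn (hv.mono hsub), fun x hx => ?_⟩
  obtain ⟨hvx, hfix⟩ := hvM x (hsub hx)
  rw [hΦ, hMc (hout x hx)] at hfix
  exact isSpinor_of_spinorMatrix_mulVec (hne x (hout x hx)) hvx hfix

end SpinorMatrix

section Sections

open Module Submodule
open scoped RealInnerProductSpace

variable {E : Type*} [NormedAddCommGroup E] [InnerProductSpace ℝ E]

/-- A planar section of the unit sphere with one of its points removed embeds in the line. -/
theorem exists_continuousOn_injOn_circle [FiniteDimensional ℝ E] {N : Submodule ℝ E}
    (hN : finrank ℝ N + 2 = finrank ℝ E) {c : E} (hc : ‖c‖ = 1) :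
    ∃ ψ : E → ℝ, ContinuousOn ψ {y | ‖y‖ = 1 ∧ y ≠ c ∧ ∀ z ∈ N, ⟪y, z⟫ = ⟪c, z⟫} ∧
      InjOn ψ {y | ‖y‖ = 1 ∧ y ≠ c ∧ ∀ z ∈ N, ⟪y, z⟫ = ⟪c, z⟫} := by
  set C := {y | ‖y‖ = 1 ∧ y ≠ c ∧ ∀ z ∈ N, ⟪y, z⟫ = ⟪c, z⟫}
  have hnorm : ∀ y ∈ C, ‖y - c‖ ^ 2 = -2 * ⟪y - c, c⟫ := fun y hy => by
    rw [norm_sub_sq_real, inner_sub_left, real_inner_self_eq_norm_sq, hy.1, hc]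
    ring
  have hneg : ∀ y ∈ C, ⟪y - c, c⟫ < 0 := fun y hy => by
    have : 0 < ‖y - c‖ := norm_pos_iff.2 (sub_ne_zero.2 hy.2.1)
    nlinarith [hnorm y hy]
  rcases C.eq_empty_or_nonempty with h0 | ⟨y₀, hy₀⟩
  · exact ⟨0, by simp [h0], by simp [h0]⟩
  have hcN : c ∉ N := fun h => by
    have := hneg y₀ hy₀
    rw [inner_sub_left, hy₀.2.2 c h, sub_self] at this
    exact this.false
  have hrank : finrank ℝ ↥(N ⊔ ℝ ∙ c)ᗮ = 1 := by
    have h₁ := (N ⊔ ℝ ∙ c).finrank_add_finrank_orthogonal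
    have h₂ := finrank_sup_span_singleton hcN
    omega
  obtain ⟨⟨τ, _⟩, -, hgen⟩ := finrank_eq_one_iff'.1 hrank
  have hzero : ∀ w : E, (∀ z ∈ N, ⟪w, z⟫ = 0) → ⟪w, c⟫ = 0 → ⟪w, τ⟫ = 0 → w = 0 := by
    intro w hwN hwc hwτ
    have hw : w ∈ (N ⊔ ℝ ∙ c)ᗮ := by
      rw [← inf_orthogonal, mem_inf, mem_orthogonal', mem_orthogonal_singleton_iff_inner_left]
      exact ⟨hwN, hwc⟩
    obtain ⟨k, hk⟩ := hgen ⟨w, hw⟩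
    have hk : k • τ = w := congrArg Subtype.val hk
    have : ⟪w, w⟫ = 0 := by
      nth_rewrite 2 [← hk]
      rw [inner_smul_right, hwτ, mul_zero]
    exact inner_self_eq_zero.1 this
  refine ⟨fun y => ⟪y - c, τ⟫ / ⟪y - c, c⟫, ContinuousOn.div (by fun_prop) (by fun_prop)
    fun y hy => (hneg y hy).ne, fun y hy y' hy' h => ?_⟩
  have hb := hneg y hy
  have hb' := hneg y' hy'
  have hprop : ⟪y' - c, c⟫ • (y - c) - ⟪y - c, c⟫ • (y' - c) = 0 := by
    refine hzero _ (fun z hz => ?_) ?_ ?_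
    · simp only [inner_sub_left, real_inner_smul_left, hy.2.2 z hz, hy'.2.2 z hz]
      ring
    · simp only [inner_sub_left _ _ c, real_inner_smul_left]
      ring
    · rw [div_eq_div_iff hb.ne hb'.ne] at h
      rw [inner_sub_left, real_inner_smul_left, real_inner_smul_left]
      linear_combination h
  rw [sub_eq_zero] at hprop
  have hsq := congrArg (fun v => ‖v‖ ^ 2) hprop
  simp only [norm_smul, mul_pow, hnorm y hy, hnorm y' hy', Real.norm_eq_abs, sq_abs] at hsq
  have heq : ⟪y' - c, c⟫ = ⟪y - c, c⟫ :=
    mul_left_cancel₀ (mul_ne_zero hb.ne hb'.ne) (by linear_combination -hsq / 2)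
  rw [heq] at hprop
  exact sub_left_injective (smul_right_injective E hb.ne hprop)

/-- Given three points of the unit sphere, some linear functional puts a prescribed one of them
strictly between the other two. -/
theorem exists_inner_lt_inner_lt {s u t : E} (hs : ‖s‖ = 1) (hu : ‖u‖ = 1) (ht : ‖t‖ = 1)
    (hus : u ≠ s) (htu : t ≠ u) (hst : s ≠ t) :
    ∃ v : E, ⟪s, v⟫ < ⟪u, v⟫ ∧ ⟪u, v⟫ < ⟪t, v⟫ := by
  obtain ⟨p, rfl⟩ : ∃ p, s = u - p := ⟨u - s, by abel⟩
  obtain ⟨q, rfl⟩ : ∃ q, t = u + q := ⟨t - u, by abel⟩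
  have hp : 0 < ‖p‖ := norm_pos_iff.2 fun h => hus (by simp [h])
  have hq : 0 < ‖q‖ := norm_pos_iff.2 fun h => htu (by simp [h])
  have hps := norm_sub_sq_real u p
  have hqs := norm_add_sq_real u q
  rw [hs, hu] at hps
  rw [ht, hu] at hqs
  have hpq : 0 < ‖p‖ * ‖q‖ + ⟪p, q⟫ := by
    refine lt_of_le_of_ne ?_ fun h => hst ?_
    · have := real_inner_le_norm p (-q)
      rw [inner_neg_right, norm_neg] at this
      linarith
    have h' : ⟪p, -q⟫ = ‖p‖ * ‖-q‖ := by
      rw [inner_neg_right, norm_neg]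
      linarith
    rw [inner_eq_norm_mul_iff_real, norm_neg] at h'
    have hin := congrArg (fun w => ⟪u, w⟫) h'
    simp only [inner_smul_right, inner_neg_right] at hin
    have heq : ‖p‖ = ‖q‖ :=
      mul_left_cancel₀ (mul_pos hp hq).ne' (by linear_combination 2 * hin - ‖q‖ * hps + ‖p‖ * hqs)
    rw [heq] at h'
    rw [smul_right_injective E hq.ne' h', sub_neg_eq_add]
  refine ⟨‖q‖ • p + ‖p‖ • q, ?_, ?_⟩
  · rw [inner_sub_left, sub_lt_self_iff, inner_add_right, inner_smul_right, inner_smul_right,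
      real_inner_self_eq_norm_sq]
    nlinarith
  · rw [inner_add_left, lt_add_iff_pos_right, inner_add_right, inner_smul_right, inner_smul_right,
      real_inner_self_eq_norm_sq, real_inner_comm]
    nlinarith

theorem inner_eq_of_mem_sphere {y₀ : Metric.sphere (0 : E) 1} {ε : ℝ}
    {y : Metric.sphere (0 : E) 1} (hy : y ∈ Metric.sphere y₀ ε) :
    ⟪(y : E), (y₀ : E)⟫ = 1 - ε ^ 2 / 2 := by
  have h : ‖(y : E) - y₀‖ = ε := by rw [← dist_eq_norm]; exact hy
  have := norm_sub_sq_real (y : E) y₀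
  rw [h, norm_eq_of_mem_sphere, norm_eq_of_mem_sphere] at this
  linarith

end Sections

section Darboux

variable {X Y : Type*} [TopologicalSpace X]

/-- A Darboux map from a locally connected space is continuous as soon as the preimages of small
spheres are closed. -/
theorem continuous_of_isClosed_preimage_sphere [LocallyConnectedSpace X] [PseudoMetricSpace Y]
    {f : X → Y} (hf : ∀ C, IsPreconnected C → IsPreconnected (f '' C)) {r : ℝ} (hr : 0 < r)
    (h : ∀ y ε, 0 < ε → ε < r → IsClosed (f ⁻¹' Metric.sphere y ε)) : Continuous f := by
  refine continuous_iff_continuousAt.2 fun x => Metric.tendsto_nhds.2 fun ε hε => ?_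
  obtain ⟨δ, hδ, hδε⟩ := exists_between (lt_min hε hr)
  have hx : x ∈ (f ⁻¹' Metric.sphere (f x) δ)ᶜ := fun hx => hδ.ne (by simpa using hx)
  filter_upwards [connectedComponentIn_mem_nhds
    ((h (f x) δ hδ (hδε.trans_le (min_le_right _ _))).isOpen_compl.mem_nhds hx)] with y hy
  by_contra! hle
  refine not_isPreconnected_of_forall_ne (g := fun z => dist z (f x)) (c := δ) (by fun_prop) ?_
    (mem_image_of_mem f (mem_connectedComponentIn hx)) (mem_image_of_mem f hy) (by simpa using hδ)
    ((hδε.trans_le (min_le_left _ _)).trans_le hle) (hf _ isPreconnected_connectedComponentIn)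
  rintro _ ⟨z, hz, rfl⟩ hzδ
  exact connectedComponentIn_subset _ _ hz hzδ

/-- The preimage under a Darboux bijection of a small sphere around a point of the unit sphere
contains the complement of two disjoint nonempty open sets. -/
theorem exists_disjoint_isOpen_preimage_sphere {E : Type*} [NormedAddCommGroup E]
    [CompletelyNormalSpace X] [NormedSpace ℝ E]
    {f : X → Metric.sphere (0 : E) 1} (hsurj : Function.Surjective f)
    (hf : ∀ C, IsPreconnected C → IsPreconnected (f '' C))
    (y₀ : Metric.sphere (0 : E) 1) {ε : ℝ} (hε : 0 < ε) (hε' : ε < 2) :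
    ∃ U V : Set X, IsOpen U ∧ IsOpen V ∧ Disjoint U V ∧ U.Nonempty ∧ V.Nonempty ∧
      (U ∪ V)ᶜ ⊆ f ⁻¹' Metric.sphere y₀ ε := by
  have hdist : dist (-y₀) y₀ = 2 := by
    rw [Subtype.dist_eq, dist_eq_norm, coe_neg_sphere, ← neg_add', norm_neg, ← two_smul ℝ,
      norm_smul, norm_eq_of_mem_sphere]
    norm_num
  have hnot : ¬ IsPreconnected (f ⁻¹' Metric.sphere y₀ ε)ᶜ := fun h => by
    have himage := hf _ h
    rw [← preimage_compl, image_preimage_eq _ hsurj] at himage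
    exact not_isPreconnected_of_forall_ne (g := fun z => dist z y₀) (c := ε) (by fun_prop)
      (fun z hz => hz) (a := y₀) (b := -y₀)
      (fun h => hε.ne (by simpa using h)) (fun h => hε'.ne' (hdist.symm.trans h))
      (by simpa using hε) (by simpa [hdist] using hε') himage
  obtain ⟨U, V, hU, hV, hUV, hsub, hU0, hV0⟩ := exists_disjoint_isOpen_of_not_isPreconnected hnot
  exact ⟨U, V, hU, hV, hUV, hU0.mono inter_subset_right, hV0.mono inter_subset_right,
    compl_subset_comm.1 hsub⟩

/-- An injective Darboux map sending a compact set into a punctured planar section of the unit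
sphere forces continuous logarithms to exist on the compact set. -/
theorem hasLogOn_of_mapsTo_circle {E : Type*} [NormedAddCommGroup E] [InnerProductSpace ℝ E]
    [FiniteDimensional ℝ E] [CompletelyNormalSpace X] [T2Space X] {f : X → Metric.sphere (0 : E) 1}
    (hinj : Function.Injective f) (hf : ∀ C, IsPreconnected C → IsPreconnected (f '' C))
    {N : Submodule ℝ E} (hN : Module.finrank ℝ N + 2 = Module.finrank ℝ E)
    {c : Metric.sphere (0 : E) 1} {L : Set X} (hL : IsCompact L) (hcL : c ∉ f '' L)
    (hLN : ∀ x ∈ L, ∀ z ∈ N, inner ℝ (f x : E) z = inner ℝ (c : E) z)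
    {h : X → ℂ} (hh : ContinuousOn h L) (h0 : ∀ x ∈ L, h x ≠ 0) : HasLogOn h L := by
  obtain ⟨ψ, hψ, hψinj⟩ := exists_continuousOn_injOn_circle hN (norm_eq_of_mem_sphere c)
  have hmaps : ∀ x ∈ L, (f x : E) ∈
      {y : E | ‖y‖ = 1 ∧ y ≠ c ∧ ∀ z ∈ N, inner ℝ y z = inner ℝ (c : E) z} :=
    fun x hx => ⟨norm_eq_of_mem_sphere _, fun h => hcL ⟨x, hx, Subtype.ext h⟩, hLN x hx⟩
  refine hasLogOn_of_injOn_real hL (φ := fun x => ψ (f x)) (fun x hx y hy hxy => ?_)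
    (fun M hM hMc => ?_) hh h0
  · exact hinj (Subtype.ext (hψinj (hmaps x hx) (hmaps y hy) hxy))
  · have := ((hf M hMc).image Subtype.val continuous_subtype_val.continuousOn).image ψ
      (hψ.mono (by rintro _ ⟨_, ⟨x, hx, rfl⟩, rfl⟩; exact hmaps x (hM hx)))
    rwa [image_image, image_image] at this

end Darboux

section Chart

theorem exists_openPartialHomeomorph_sphere {n : ℕ} {E F : Type*} [NormedAddCommGroup E]
    [InnerProductSpace ℝ E] [Fact (Module.finrank ℝ E = n + 1)] [NormedAddCommGroup F]
    (g : EuclideanSpace ℝ (Fin n) ≃ₜ F) (p q : Metric.sphere (0 : E) 1) :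
    ∃ e : OpenPartialHomeomorph (Metric.sphere (0 : E) 1) F,
      e.source = {q}ᶜ ∧ e.target = univ ∧ e p = 0 :=
  ⟨(stereographic' n q).transHomeomorph
    (g.trans (Homeomorph.subRight (g (stereographic' n q p)))), by simp, by simp, by simp⟩

/-- In a chart covering the complement of a point `q` of a compact space, a neighbourhood `U` of
the origin disjoint from a neighbourhood `V` of `q` becomes bounded. -/
theorem OpenPartialHomeomorph.exists_isBounded_frontier_subset {X F : Type*} [TopologicalSpace X]
    [CompactSpace X] [PseudoMetricSpace F] {e : OpenPartialHomeomorph X F} {p q : X}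
    (hs : e.source = {q}ᶜ) (ht : e.target = univ) {U V : Set X} (hU : IsOpen U) (hV : IsOpen V)
    (hUV : Disjoint U V) (hp : p ∈ U) (hq : q ∈ V) :
    ∃ W : Set F, IsOpen W ∧ Bornology.IsBounded W ∧ e p ∈ W ∧
      frontier W ⊆ e.symm ⁻¹' (U ∪ V)ᶜ := by
  have hsymm : Continuous e.symm := by
    rw [← continuousOn_univ, ← ht]
    exact e.continuousOn_symm
  have hsource : Vᶜ ⊆ e.source := fun x hx => hs ▸ fun h => hx (h ▸ hq)
  refine ⟨e.symm ⁻¹' U, hU.preimage hsymm, ?_, ?_, ?_⟩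
  · refine (hV.isClosed_compl.isCompact.image_of_continuousOn
      (e.continuousOn.mono hsource)).isBounded.subset fun x hx => ?_
    exact ⟨e.symm x, hUV.notMem_of_mem_left hx, e.right_inv (ht ▸ mem_univ x)⟩
  · rwa [mem_preimage, e.left_inv (hsource (hUV.notMem_of_mem_left hp))]
  · intro x hx hxUV
    rw [(hU.preimage hsymm).frontier_eq] at hx
    refine hxUV.elim hx.2 fun hxV => ?_
    obtain ⟨y, hyV, hyU⟩ := mem_closure_iff.1 hx.1 _ (hV.preimage hsymm) hxV
    exact hUV.notMem_of_mem_left hyU hyV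

theorem HasLogOn.comp_right {X Y : Type*} [TopologicalSpace X] [TopologicalSpace Y] {h : X → ℂ}
    {K : Set X} (hK : HasLogOn h K) {g : Y → X} (hg : Continuous g) :
    HasLogOn (h ∘ g) (g ⁻¹' K) := by
  obtain ⟨l, hl, hexp⟩ := hK
  exact ⟨l ∘ g, hl.comp hg.continuousOn fun _ hx => hx, fun x hx => hexp _ hx⟩

theorem HasSpinorOn.comp_right {X Y : Type*} [TopologicalSpace X] [TopologicalSpace Y]
    {d : X → EuclideanSpace ℝ (Fin 3)} {K : Set X} (hK : HasSpinorOn d K) {g : Y → X}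
    (hg : Continuous g) : HasSpinorOn (d ∘ g) (g ⁻¹' K) := by
  obtain ⟨a, b, ha, hb, hab⟩ := hK
  exact ⟨a ∘ g, b ∘ g, ha.comp hg.continuousOn fun _ hx => hx,
    hb.comp hg.continuousOn fun _ hx => hx, fun x hx => hab _ hx⟩

end Chart

section Sphere

variable {n : ℕ}

theorem finite_sphere_circle (y₀ : Metric.sphere (0 : EuclideanSpace ℝ (Fin 2)) 1) (ε : ℝ) :
    (Metric.sphere y₀ ε).Finite := by
  have hsq : ∀ y : Metric.sphere (0 : EuclideanSpace ℝ (Fin 2)) 1,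
      y.1 0 ^ 2 + y.1 1 ^ 2 = 1 := fun y => by
    have := EuclideanSpace.real_norm_sq_eq y.1
    rw [norm_eq_of_mem_sphere, Fin.sum_univ_two] at this
    linarith
  have hinner : ∀ y ∈ Metric.sphere y₀ ε,
      y.1 0 * y₀.1 0 + y.1 1 * y₀.1 1 = 1 - ε ^ 2 / 2 := fun y hy => by
    rw [← inner_eq_of_mem_sphere hy]
    simp [PiLp.inner_apply, Fin.sum_univ_two, mul_comm]
  have h₀ := hsq y₀
  refine Set.Finite.of_injOn (f := fun y => y₀.1 0 * y.1 1 - y₀.1 1 * y.1 0)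
    (t := {t : ℝ | t ^ 2 = 1 - (1 - ε ^ 2 / 2) ^ 2}) (fun y hy => ?_) (fun y hy y' hy' h => ?_) ?_
  · have h₁ := hsq y
    rw [mem_ofPred_eq, ← hinner y hy]
    linear_combination h₀ * (y.1 0 ^ 2 + y.1 1 ^ 2) + h₁
  · have h₁ := (hinner y hy).trans (hinner y' hy').symm
    simp only at h
    ext i
    fin_cases i
    · simp only [Fin.zero_eta]
      linear_combination y₀.1 0 * h₁ - y₀.1 1 * h - (y.1 0 - y'.1 0) * h₀
    · simp only [Fin.mk_one]
      linear_combination y₀.1 1 * h₁ + y₀.1 0 * h - (y.1 1 - y'.1 1) * h₀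
  · rcases lt_or_ge (1 - (1 - ε ^ 2 / 2) ^ 2) 0 with hneg | hnn
    · exact finite_empty.subset fun t ht => (hneg.not_ge (ht ▸ sq_nonneg t)).elim
    · refine (toFinite {√(1 - (1 - ε ^ 2 / 2) ^ 2), -√(1 - (1 - ε ^ 2 / 2) ^ 2)}).subset
        fun t ht => ?_
      exact sq_eq_sq_iff_eq_or_eq_neg.1 (ht.trans (Real.sq_sqrt hnn).symm)

variable {f : Metric.sphere (0 : EuclideanSpace ℝ (Fin (n + 1))) 1 →
  Metric.sphere (0 : EuclideanSpace ℝ (Fin (n + 1))) 1}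

/-- A compact set separating two points of the sphere inside the preimage of a small sphere,
seen in a chart centred at one of the two points and sending the other one to infinity. -/
theorem exists_separator_in_chart (hsurj : Function.Surjective f)
    (hf : ∀ C, IsPreconnected C → IsPreconnected (f '' C)) {F : Type*} [NormedAddCommGroup F]
    (g : EuclideanSpace ℝ (Fin n) ≃ₜ F) (y₀ : Metric.sphere (0 : EuclideanSpace ℝ (Fin (n + 1))) 1)
    {ε : ℝ} (hε : 0 < ε) (hε' : ε < 2) :
    ∃ (K : Set (Metric.sphere (0 : EuclideanSpace ℝ (Fin (n + 1))) 1))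
      (d : Metric.sphere (0 : EuclideanSpace ℝ (Fin (n + 1))) 1 → F)
      (i : F → Metric.sphere (0 : EuclideanSpace ℝ (Fin (n + 1))) 1) (W : Set F),
      IsClosed K ∧ K ⊆ f ⁻¹' Metric.sphere y₀ ε ∧ ContinuousOn d K ∧ (∀ x ∈ K, d x ≠ 0) ∧
      Continuous i ∧ d ∘ i = id ∧ IsOpen W ∧ Bornology.IsBounded W ∧ 0 ∈ W ∧
      frontier W ⊆ i ⁻¹' K := by
  obtain ⟨U, V, hU, hV, hUV, ⟨p, hp⟩, ⟨q, hq⟩, hsub⟩ :=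
    exists_disjoint_isOpen_preimage_sphere hsurj hf y₀ hε hε'
  have : Fact (Module.finrank ℝ (EuclideanSpace ℝ (Fin (n + 1))) = n + 1) := ⟨by simp⟩
  obtain ⟨e, hs, ht, hep⟩ := exists_openPartialHomeomorph_sphere g p q
  obtain ⟨W, hW, hWb, h0, hfr⟩ := e.exists_isBounded_frontier_subset hs ht hU hV hUV hp hq
  have hsource : ∀ x ∉ V, x ∈ e.source := fun x hx => hs ▸ fun h => hx (h ▸ hq)
  have hK : (U ∪ V)ᶜ ⊆ e.source := fun x hx => hsource x fun h => hx (.inr h)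
  refine ⟨(U ∪ V)ᶜ, e, e.symm, W, (hU.union hV).isClosed_compl, hsub, e.continuousOn.mono hK,
    fun x hx hx0 => hx (.inl ?_), ?_, ?_, hW, hWb, hep ▸ h0, hfr⟩
  · rwa [e.injOn (hK hx) (hsource p (hUV.notMem_of_mem_left hp)) (hx0.trans hep.symm)]
  · rw [← continuousOn_univ, ← ht]
    exact e.continuousOn_symm
  · exact funext fun x => e.right_inv (ht ▸ mem_univ x)

end Sphere

theorem isClosed_preimage_sphere_two
    {f : Metric.sphere (0 : EuclideanSpace ℝ (Fin 3)) 1 →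
      Metric.sphere (0 : EuclideanSpace ℝ (Fin 3)) 1} (hbij : Function.Bijective f)
    (hf : ∀ C, IsPreconnected C → IsPreconnected (f '' C))
    (y₀ : Metric.sphere (0 : EuclideanSpace ℝ (Fin 3)) 1) {ε : ℝ} (hε : 0 < ε) (hε' : ε < 2) :
    IsClosed (f ⁻¹' Metric.sphere y₀ ε) := by
  obtain ⟨K, d, i, W, hK, hsub, hd, hd0, hi, hdi, hW, hWb, h0, hfr⟩ :=
    exists_separator_in_chart hbij.2 hf
      Complex.orthonormalBasisOneI.repr.symm.toHomeomorph y₀ hε hε'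
  have hlog : ¬ HasLogOn d K := fun h =>
    not_hasLogOn_id_of_frontier_subset hW hWb h0 (hK.preimage hi) hfr (hdi ▸ h.comp_right hi)
  have hin : ∀ x ∈ f ⁻¹' Metric.sphere y₀ ε, inner ℝ (f x).1 y₀.1 = 1 - ε ^ 2 / 2 := fun x hx =>
    inner_eq_of_mem_sphere (mem_preimage.1 hx)
  suffices f ⁻¹' Metric.sphere y₀ ε ⊆ K from hsub.antisymm this ▸ hK
  intro x hx
  by_contra hxK
  refine hlog (hasLogOn_of_mapsTo_circle (N := Submodule.span ℝ {y₀.1}) hbij.1 hf ?_ (c := f x)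
    hK.isCompact (fun h => hxK ((hbij.1.mem_set_image).1 h)) (fun y hy z hz => ?_) hd hd0)
  · rw [finrank_span_singleton (ne_zero_of_mem_unit_sphere y₀)]
    simp
  · obtain ⟨k, rfl⟩ := Submodule.mem_span_singleton.1 hz
    rw [inner_smul_right, inner_smul_right, hin y (hsub hy), hin x hx]

theorem isClosed_preimage_sphere_three
    {f : Metric.sphere (0 : EuclideanSpace ℝ (Fin 4)) 1 →
      Metric.sphere (0 : EuclideanSpace ℝ (Fin 4)) 1} (hbij : Function.Bijective f)
    (hf : ∀ C, IsPreconnected C → IsPreconnected (f '' C))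
    (y₀ : Metric.sphere (0 : EuclideanSpace ℝ (Fin 4)) 1) {ε : ℝ} (hε : 0 < ε) (hε' : ε < 2) :
    IsClosed (f ⁻¹' Metric.sphere y₀ ε) := by
  obtain ⟨L, d, i, W, hL, hsub, hd, hd0, hi, hdi, hW, hWb, h0, hfr⟩ :=
    exists_separator_in_chart hbij.2 hf (Homeomorph.refl _) y₀ hε hε'
  have hspin : ¬ HasSpinorOn d L := fun h =>
    not_hasSpinorOn_id_of_frontier_subset hW hWb h0 (hL.preimage hi) hfr (hdi ▸ h.comp_right hi)
  obtain ⟨K, hKL, hK, hKspin, hmin⟩ := exists_minimal_isClosed_of_not hL.isCompact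
    (P := HasSpinorOn d) (fun K _ hK h =>
      (HasSpinorOn.exists_isOpen hd hd0 hL hK h).imp fun N hN =>
        ⟨hN.1, hN.2.1, fun M hM _ => hN.2.2 M hM⟩) hspin
  have hKsub := hKL.trans hsub
  have hin : ∀ x ∈ f ⁻¹' Metric.sphere y₀ ε, inner ℝ (f x).1 y₀.1 = 1 - ε ^ 2 / 2 := fun x hx =>
    inner_eq_of_mem_sphere (mem_preimage.1 hx)
  suffices f ⁻¹' Metric.sphere y₀ ε ⊆ K from hKsub.antisymm this ▸ hK
  obtain ⟨s, hs, t, ht, hst⟩ := not_subsingleton_iff.1 fun h => hKspin h.hasSpinorOn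
  intro u hu
  by_contra huK
  have hne : ∀ {x y}, x ≠ y → (f x).1 ≠ (f y).1 := fun h h' => h (hbij.1 (Subtype.ext h'))
  obtain ⟨v, hsv, htv⟩ := exists_inner_lt_inner_lt (norm_eq_of_mem_sphere (f s))
    (norm_eq_of_mem_sphere (f u)) (norm_eq_of_mem_sphere (f t))
    (hne fun h => huK (h ▸ hs)) (hne fun h => huK (h ▸ ht)) (hne hst)
  have hnot : ¬ IsPreconnected (K \ {x | inner ℝ (f x).1 v = inner ℝ (f u).1 v}) := fun h => by
    refine not_isPreconnected_of_forall_ne (g := fun y => inner ℝ y.1 v) (by fun_prop) ?_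
      (mem_image_of_mem f ?_) (mem_image_of_mem f ?_) hsv htv (hf _ h)
    · rintro _ ⟨x, hx, rfl⟩
      exact hx.2
    · exact ⟨hs, hsv.ne⟩
    · exact ⟨ht, htv.ne'⟩
  obtain ⟨A, B, hA, hB, rfl, hAne, hBne, hAB⟩ :=
    exists_isClosed_union_of_not_isPreconnected_diff hK hnot
  refine hKspin (HasSpinorOn.union (fun x hx => hd0 x (hKL (.inl hx.1))) hA hB
    (hmin A subset_union_left hA hAne) (hmin B subset_union_right hB hBne) fun h hh hh0 => ?_)
  have hv : v ∉ Submodule.span ℝ {y₀.1} := fun hv => by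
    obtain ⟨k, rfl⟩ := Submodule.mem_span_singleton.1 hv
    rw [inner_smul_right, inner_smul_right, hin s (hKsub hs), hin u hu] at hsv
    exact hsv.false
  refine hasLogOn_of_mapsTo_circle (N := Submodule.span ℝ {y₀.1} ⊔ Submodule.span ℝ {v}) hbij.1 hf
    ?_ (c := f u) (hA.inter hB).isCompact
    (fun h => huK (.inl ((hbij.1.mem_set_image).1 h).1)) (fun y hy z hz => ?_) hh hh0
  · rw [Submodule.finrank_sup_span_singleton hv,
      finrank_span_singleton (ne_zero_of_mem_unit_sphere y₀)]
    simp
  · obtain ⟨z₁, hz₁, z₂, hz₂, rfl⟩ := Submodule.mem_sup.1 hz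
    obtain ⟨k, rfl⟩ := Submodule.mem_span_singleton.1 hz₁
    obtain ⟨l, rfl⟩ := Submodule.mem_span_singleton.1 hz₂
    simp only [inner_add_right, inner_smul_right, hin y (hKsub (.inl hy.1)), hin u hu,
      show inner ℝ (f y).1 v = inner ℝ (f u).1 v from hAB hy]

/-- For every natural number `n` with `1 ≤ n ≤ 3`, every Darboux bijection
`f : Sⁿ → Sⁿ` of the `n`-dimensional sphere onto itself is a homeomorphism. -/
theorem darboux_bijection_sphere_isHomeomorph (n : ℕ) (hn1 : 1 ≤ n) (hn3 : n ≤ 3)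
    (f : (Metric.sphere (0 : EuclideanSpace ℝ (Fin (n + 1))) 1) →
         (Metric.sphere (0 : EuclideanSpace ℝ (Fin (n + 1))) 1))
    (hbij : Function.Bijective f)
    (hdarboux : ∀ C : Set (Metric.sphere (0 : EuclideanSpace ℝ (Fin (n + 1))) 1),
      IsPreconnected C → IsPreconnected (f '' C)) :
    IsHomeomorph f := by
  have : Fact (Module.finrank ℝ (EuclideanSpace ℝ (Fin (n + 1))) = n + 1) := ⟨by simp⟩
  have := ChartedSpace.locallyConnectedSpace (EuclideanSpace ℝ (Fin n))
    (Metric.sphere (0 : EuclideanSpace ℝ (Fin (n + 1))) 1)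
  refine isHomeomorph_iff_continuous_bijective.2 ⟨?_, hbij⟩
  refine continuous_of_isClosed_preimage_sphere hdarboux two_pos fun y₀ ε hε hε' => ?_
  obtain rfl | rfl | rfl : n = 1 ∨ n = 2 ∨ n = 3 := by omega
  · exact ((finite_sphere_circle y₀ ε).preimage hbij.1.injOn).isClosed
  · exact isClosed_preimage_sphere_two hbij hdarboux y₀ hε hε'
  · exact isClosed_preimage_sphere_three hbij hdarboux y₀ hε hε'
end

section
/- Let X be a nonempty m-manifold, let Y be an n-manifold with n ≤ 3, and suppose there exists a Darboux injection f : X → Y. Then m ≤ n. -/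
/-- The half-space `ℝᵏ₊ = {(x₁, …, x_k) ∈ ℝᵏ : x₁ ≥ 0}` (for `k ≥ 1`; the condition
is stated as `0 ≤ x i` for the coordinate `i` with `i.val = 0`). -/
def halfSpace (k : ℕ) : Set (EuclideanSpace ℝ (Fin k)) :=
  {x | ∀ i : Fin k, (i : ℕ) = 0 → 0 ≤ x i}

/-- A `k`-manifold (for `k ≥ 1`) is a metrizable space in which every point has an
open neighborhood homeomorphic to an open subset of the half-space `ℝᵏ₊`. -/
def IsManifoldOfDim (k : ℕ) (X : Type*) [TopologicalSpace X] : Prop :=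
  TopologicalSpace.MetrizableSpace X ∧
    ∀ x : X, ∃ U : Set X, IsOpen U ∧ x ∈ U ∧
      ∃ V : Set (halfSpace k), IsOpen V ∧ Nonempty (U ≃ₜ V)

open Set Topology

/-- `IsThick n K` says that `K` contains a hierarchy of `n` nested Cantor-manifold-like
continua: some nondegenerate compact `M ⊆ K` cannot be written as the union of two proper
closed subsets unless their intersection is `IsThick (n - 1)`. -/
def IsThick {W : Type*} [TopologicalSpace W] : ℕ → Set W → Prop
  | 0, K => K.Nonempty
  | n + 1, K => ∃ M ⊆ K, IsCompact M ∧ M.Nontrivial ∧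
      ∀ M₁ M₂ : Set W, IsCompact M₁ → IsCompact M₂ → M₁ ∪ M₂ = M → M₁ ≠ M → M₂ ≠ M →
        IsThick n (M₁ ∩ M₂)

/-- `SepDimLT n S` says that `S` has dimension less than `n`, in the sense that any two points
of `S` are separated in `S` by a set of dimension less than `n - 1`. -/
def SepDimLT {Y : Type*} [TopologicalSpace Y] : ℕ → Set Y → Prop
  | 0, S => S = ∅
  | n + 1, S => ∀ p ∈ S, ∀ q ∈ S, p ≠ q → ∃ U V : Set Y, IsOpen U ∧ IsOpen V ∧ p ∈ U ∧ q ∈ V ∧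
      S ∩ (U ∩ V) = ∅ ∧ SepDimLT n (S \ (U ∪ V))

theorem IsThick.of_succ {W : Type*} [TopologicalSpace W] {n : ℕ} :
    ∀ {K : Set W}, IsThick (n + 1) K → IsThick n K := by
  induction n with
  | zero =>
    rintro K ⟨M, hMK, -, hM, -⟩
    exact hM.nonempty.mono hMK
  | succ n ih =>
    rintro K ⟨M, hMK, hMc, hM, h⟩
    exact ⟨M, hMK, hMc, hM, fun M₁ M₂ h₁ h₂ hu hn₁ hn₂ => ih (h M₁ M₂ h₁ h₂ hu hn₁ hn₂)⟩

theorem IsThick.of_le {W : Type*} [TopologicalSpace W] {n m : ℕ} (hnm : n ≤ m) {K : Set W}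
    (hK : IsThick m K) : IsThick n K := by
  induction hnm with
  | refl => exact hK
  | step _ ih => exact ih hK.of_succ

/-- A Darboux injection does not lower the dimension. -/
theorem IsThick.not_sepDimLT_of_darboux {W Y : Type*} [TopologicalSpace W] [T2Space W]
    [CompletelyNormalSpace W] [TopologicalSpace Y] (f : W → Y) {n : ℕ} :
    ∀ {K : Set W} {S : Set Y}, IsThick n K → InjOn f K →
      (∀ C ⊆ K, IsPreconnected C → IsPreconnected (f '' C)) → MapsTo f K S → ¬ SepDimLT n S := by
  induction n with
  | zero =>
    rintro K S ⟨x, hx⟩ - - hKS rfl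
    exact hKS hx
  | succ n ih =>
    rintro K S ⟨M, hMK, hMc, ⟨p, hp, q, hq, hpq⟩, hM⟩ hinj hdar hKS hS
    obtain ⟨U, V, hU, hV, hpU, hqV, hUV, hres⟩ := hS (f p) (hKS (hMK hp)) (f q) (hKS (hMK hq))
      (fun h => hpq (hinj (hMK hp) (hMK hq) h))
    set Z : Set W := M ∩ f ⁻¹' (U ∪ V) with hZ
    have hZK : Z ⊆ K := inter_subset_left.trans hMK
    have hZn : ¬ IsPreconnected Z := by
      intro h
      obtain ⟨y, hy, hyUV⟩ := hdar Z hZK h U V hU hV (image_subset_iff.2 inter_subset_right)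
        ⟨f p, ⟨p, ⟨hp, Or.inl hpU⟩, rfl⟩, hpU⟩ ⟨f q, ⟨q, ⟨hq, Or.inr hqV⟩, rfl⟩, hqV⟩
      obtain ⟨x, hx, rfl⟩ := hy
      exact (hUV ▸ (⟨hKS (hZK hx), hyUV⟩ : f x ∈ S ∩ (U ∩ V)) : f x ∈ (∅ : Set Y))
    unfold IsPreconnected at hZn
    push Not at hZn
    obtain ⟨u, v, hu, hv, hZuv, ⟨a, haZ, hau⟩, ⟨b, hbZ, hbv⟩, hemp⟩ := hZn
    have hdisj : Disjoint (𝓝ˢ (Z ∩ u)) (𝓝ˢ (Z ∩ v)) := by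
      apply completely_normal
      · rw [disjoint_left]
        rintro x hx ⟨hxZ, hxv⟩
        obtain ⟨y, hyv, hyZ, hyu⟩ := mem_closure_iff.1 hx v hv hxv
        exact (hemp ▸ (⟨hyZ, hyu, hyv⟩ : y ∈ Z ∩ (u ∩ v)) : y ∈ (∅ : Set W))
      · rw [disjoint_left]
        rintro x ⟨hxZ, hxu⟩ hx
        obtain ⟨y, hyu, hyZ, hyv⟩ := mem_closure_iff.1 hx u hu hxu
        exact (hemp ▸ (⟨hyZ, hyu, hyv⟩ : y ∈ Z ∩ (u ∩ v)) : y ∈ (∅ : Set W))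
    obtain ⟨u', v', hu', hv', hZu', hZv', huv'⟩ := separatedNhds_iff_disjoint.2 hdisj
    have hD := hM (M \ u') (M \ v') (hMc.diff hu') (hMc.diff hv')
      (by rw [← sdiff_inter, huv'.inter_eq, sdiff_empty])
      (fun h => ((h.symm ▸ haZ.1 : a ∈ M \ u')).2 (hZu' ⟨haZ, hau⟩))
      (fun h => ((h.symm ▸ hbZ.1 : b ∈ M \ v')).2 (hZv' ⟨hbZ, hbv⟩))
    have hDK : M \ u' ∩ (M \ v') ⊆ K := fun x hx => hMK hx.1.1
    refine ih hD (hinj.mono hDK) (fun C hC => hdar C (hC.trans hDK)) ?_ hres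
    rintro x ⟨⟨hxM, hxu⟩, -, hxv⟩
    refine ⟨hKS (hMK hxM), fun hx => ?_⟩
    have hxZ : x ∈ Z := ⟨hxM, hx⟩
    rcases hZuv hxZ with h | h
    exacts [hxu (hZu' ⟨hxZ, h⟩), hxv (hZv' ⟨hxZ, h⟩)]

theorem SepDimLT.of_injOn {Y Z : Type*} [TopologicalSpace Y] [TopologicalSpace Z] {h : Y → Z}
    {n : ℕ} : ∀ {S : Set Y} {T : Set Z}, ContinuousOn h S → InjOn h S → MapsTo h S T →
      SepDimLT n T → SepDimLT n S := by
  induction n with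
  | zero =>
    rintro S T - - hST rfl
    exact eq_empty_of_forall_notMem fun x hx => hST hx
  | succ n ih =>
    intro S T hc hi hST hT p hp q hq hpq
    obtain ⟨U, V, hU, hV, hpU, hqV, hUV, hres⟩ :=
      hT (h p) (hST hp) (h q) (hST hq) (fun e => hpq (hi hp hq e))
    obtain ⟨U', hU', hUU'⟩ := (continuousOn_iff'.1 hc) U hU
    obtain ⟨V', hV', hVV'⟩ := (continuousOn_iff'.1 hc) V hV
    have hUm : ∀ x ∈ S, (h x ∈ U ↔ x ∈ U') := fun x hx =>
      ⟨fun hxU => (hUU' ▸ (⟨hxU, hx⟩ : x ∈ h ⁻¹' U ∩ S) : x ∈ U' ∩ S).1,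
        fun hxU => (hUU' ▸ (⟨hxU, hx⟩ : x ∈ U' ∩ S) : x ∈ h ⁻¹' U ∩ S).1⟩
    have hVm : ∀ x ∈ S, (h x ∈ V ↔ x ∈ V') := fun x hx =>
      ⟨fun hxV => (hVV' ▸ (⟨hxV, hx⟩ : x ∈ h ⁻¹' V ∩ S) : x ∈ V' ∩ S).1,
        fun hxV => (hVV' ▸ (⟨hxV, hx⟩ : x ∈ V' ∩ S) : x ∈ h ⁻¹' V ∩ S).1⟩
    refine ⟨U', V', hU', hV', (hUm p hp).1 hpU, (hVm q hq).1 hqV, ?_, ?_⟩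
    · refine eq_empty_of_forall_notMem ?_
      rintro x ⟨hx, hxU, hxV⟩
      have : h x ∈ T ∩ (U ∩ V) := ⟨hST hx, (hUm x hx).2 hxU, (hVm x hx).2 hxV⟩
      rwa [hUV] at this
    · refine ih (hc.mono sdiff_subset) (hi.mono sdiff_subset) ?_ hres
      rintro x ⟨hx, hxn⟩
      refine ⟨hST hx, fun hh => hxn (hh.imp (hUm x hx).1 (hVm x hx).1)⟩

/-- A round sphere in `ℝⁿ` has dimension less than `n`. -/
theorem sepDimLT_sphere {n : ℕ} : ∀ (c : Fin n → ℝ) {s : ℝ}, s ≠ 0 →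
    SepDimLT n {x : Fin n → ℝ | ∑ i, (x i - c i) ^ 2 = s} := by
  induction n with
  | zero =>
    intro c s hs
    refine eq_empty_of_forall_notMem fun x hx => hs ?_
    simpa using hx.symm
  | succ n ih =>
    intro c s hs p hp q hq hpq
    obtain ⟨i, hi⟩ := Function.ne_iff.1 hpq
    wlog hlt : p i < q i generalizing p q
    · obtain ⟨U, V, hU, hV, h₁, h₂, h₃, h₄⟩ := this q hq p hp hpq.symm hi.symm
        (lt_of_le_of_ne (not_lt.1 hlt) hi.symm)
      exact ⟨V, U, hV, hU, h₂, h₁, by rwa [inter_comm V U], by rwa [union_comm V U]⟩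
    obtain ⟨a, ⟨hpa, haq⟩, ha⟩ : ∃ a ∈ Ioo (p i) (q i), (a - c i) ^ 2 ≠ s := by
      by_contra! hall
      have hsub : Ioo (p i) (q i) ⊆ {c i + √s, c i - √s} := by
        intro a ha
        have h := hall a ha
        have h' : (a - c i) ^ 2 = √s ^ 2 := by
          rw [h, Real.sq_sqrt (h ▸ sq_nonneg _)]
        rcases sq_eq_sq_iff_eq_or_eq_neg.1 h' with h | h
        · exact Or.inl (by linarith)
        · exact Or.inr (by simp only [mem_singleton_iff]; linarith)
      exact (Ioo_infinite hlt) ((toFinite _).subset hsub)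
    refine ⟨{x | x i < a}, {x | a < x i}, isOpen_lt (continuous_apply i) continuous_const,
      isOpen_lt continuous_const (continuous_apply i), hpa, haq, ?_, ?_⟩
    · refine eq_empty_of_forall_notMem ?_
      rintro x ⟨-, h₁, h₂⟩
      exact lt_asymm (show x i < a from h₁) (show a < x i from h₂)
    · have hxi : ∀ x ∈ {x : Fin (n + 1) → ℝ | ∑ i, (x i - c i) ^ 2 = s} \
          ({x | x i < a} ∪ {x | a < x i}), x i = a := by
        rintro x ⟨-, hx⟩
        simp only [mem_union, mem_ofPred_eq, not_or, not_lt] at hx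
        exact le_antisymm hx.2 hx.1
      refine SepDimLT.of_injOn (h := fun x j => x (i.succAbove j)) (by fun_prop) ?_ ?_
        (ih (fun j => c (i.succAbove j)) (s := s - (a - c i) ^ 2) (sub_ne_zero.2 (Ne.symm ha)))
      · intro x hx y hy hxy
        funext j
        refine Fin.succAboveCases i ?_ (fun j => congrFun hxy j) j
        rw [hxi x hx, hxi y hy]
      · intro x hx
        have h₁ : ∑ i, (x i - c i) ^ 2 = s := hx.1
        rw [Fin.sum_univ_succAbove _ i, hxi x hx] at h₁
        change ∑ j, (x (i.succAbove j) - c (i.succAbove j)) ^ 2 = _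
        linarith

theorem isClosed_halfSpace (k : ℕ) : IsClosed (halfSpace k) := by
  have : halfSpace k = ⋂ i : Fin k, ⋂ _ : (i : ℕ) = 0, {x | 0 ≤ x i} := by
    ext x
    simp [halfSpace]
  rw [this]
  exact isClosed_iInter fun i => isClosed_iInter fun _ =>
    isClosed_le continuous_const (by fun_prop)

theorem IsManifoldOfDim.sepDimLT {n : ℕ} {Y : Type*} [TopologicalSpace Y]
    (hY : IsManifoldOfDim n Y) : SepDimLT (n + 1) (univ : Set Y) := by
  classical
  obtain ⟨hmet, hY⟩ := hY
  intro p _ q _ hpq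
  obtain ⟨U, hU, hpU, V, hV, ⟨e⟩⟩ := hY p
  obtain ⟨O, hO, hOV⟩ := isOpen_induced_iff.1 hV
  set φ : Y → EuclideanSpace ℝ (Fin n) := fun y => if h : y ∈ U then ((e ⟨y, h⟩ : V) : halfSpace n)
    else 0 with hφ
  have hφU : ∀ y (h : y ∈ U), φ y = (((e ⟨y, h⟩ : V) : halfSpace n) : EuclideanSpace ℝ (Fin n)) :=
    fun y h => by simp [hφ, h]
  have hφc : ContinuousOn φ U := by
    rw [continuousOn_iff_continuous_domRestrict]
    have : U.domRestrict φ = fun u => (((e u : V) : halfSpace n) : EuclideanSpace ℝ (Fin n)) := by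
      funext u
      exact hφU u u.2
    rw [this]
    fun_prop
  have hφi : InjOn φ U := by
    intro x hx y hy hxy
    rw [hφU x hx, hφU y hy] at hxy
    simpa using e.injective (Subtype.ext (Subtype.ext hxy))
  have hφO : φ p ∈ O := by
    rw [hφU p hpU]
    have : ((e ⟨p, hpU⟩ : V) : halfSpace n) ∈ Subtype.val ⁻¹' O := hOV ▸ (e ⟨p, hpU⟩).2
    exact this
  obtain ⟨ε, hε, hεO⟩ := Metric.isOpen_iff.1 hO _ hφO
  obtain ⟨r, hr, hrε, hrq⟩ : ∃ r > 0, r < ε ∧ (q ∈ U → r < dist (φ q) (φ p)) := by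
    by_cases hq : q ∈ U
    · have hd : 0 < dist (φ q) (φ p) := dist_pos.2 fun h => hpq (hφi hq hpU h).symm
      obtain ⟨r, h₀, h₁⟩ := exists_between (lt_min hε hd)
      exact ⟨r, h₀, h₁.trans_le (min_le_left _ _), fun _ => h₁.trans_le (min_le_right _ _)⟩
    · obtain ⟨r, h₀, h₁⟩ := exists_between hε
      exact ⟨r, h₀, h₁, fun h => absurd h hq⟩
  have hrO : Metric.closedBall (φ p) r ⊆ O :=
    (Metric.closedBall_subset_ball hrε).trans hεO
  set N : Set Y := U ∩ φ ⁻¹' Metric.ball (φ p) r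
  set B : Set Y := U ∩ φ ⁻¹' Metric.closedBall (φ p) r with hB
  have hN : IsOpen N := hφc.isOpen_inter_preimage hU Metric.isOpen_ball
  have hBcl : IsClosed B := by
    have hcomp : IsCompact (Metric.closedBall (φ p) r ∩ halfSpace n) :=
      (isCompact_closedBall _ _).inter_right (isClosed_halfSpace n)
    have := isCompact_iff_compactSpace.1 hcomp
    let ψ : (Metric.closedBall (φ p) r ∩ halfSpace n : Set _) → Y := fun x =>
      (e.symm ⟨⟨x, x.2.2⟩, hOV ▸ (hrO x.2.1 : ((⟨x, x.2.2⟩ : halfSpace n) :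
        EuclideanSpace ℝ (Fin n)) ∈ O)⟩ : U)
    have hψ : Continuous ψ := by
      refine continuous_subtype_val.comp (e.symm.continuous.comp ?_)
      exact (continuous_subtype_val.subtype_mk _).subtype_mk _
    have hrange : B = range ψ := by
      ext y
      constructor
      · rintro ⟨hyU, hy⟩
        refine ⟨⟨φ y, hy, ?_⟩, ?_⟩
        · rw [hφU y hyU]
          exact Subtype.coe_prop _
        · simp only [ψ]
          simp [hφU y hyU]
      · rintro ⟨x, rfl⟩
        refine ⟨Subtype.coe_prop _, ?_⟩
        have : φ (ψ x) = x := by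
          rw [hφU _ (Subtype.coe_prop _)]
          simp
        rw [mem_preimage, this]
        exact x.2.1
    rw [hrange]
    exact (isCompact_range hψ).isClosed
  refine ⟨N, Bᶜ, hN, hBcl.isOpen_compl, ⟨hpU, Metric.mem_ball_self hr⟩,
    fun hq => (hrq hq.1).not_ge hq.2, ?_, ?_⟩
  · refine eq_empty_of_forall_notMem ?_
    rintro x ⟨-, hxN, hxB⟩
    exact hxB ⟨hxN.1, Metric.ball_subset_closedBall hxN.2⟩
  · have hsub : (univ : Set Y) \ (N ∪ Bᶜ) ⊆ U ∩ φ ⁻¹' Metric.sphere (φ p) r := by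
      rintro x ⟨-, hx⟩
      simp only [mem_union, mem_compl_iff, not_or, not_not] at hx
      exact ⟨hx.2.1, le_antisymm hx.2.2 (not_lt.1 fun h => hx.1 ⟨hx.2.1, h⟩)⟩
    refine SepDimLT.of_injOn (h := fun y i => φ y i) ?_ ?_ ?_
      (sepDimLT_sphere (fun i => φ p i) (s := r ^ 2) (by positivity))
    · have := hφc.mono (hsub.trans inter_subset_left)
      fun_prop
    · intro x hx y hy hxy
      refine hφi (hsub hx).1 (hsub hy).1 ?_
      ext i
      exact congrFun hxy i
    · intro x hx
      have h : dist (φ x) (φ p) = r := (hsub hx).2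
      rw [EuclideanSpace.dist_eq] at h
      change ∑ i, (φ x i - φ p i) ^ 2 = r ^ 2
      rw [← h, Real.sq_sqrt (by positivity)]
      simp [Real.dist_eq, sq_abs]

section Extension

variable {E : Type*} [NormedAddCommGroup E] [NormedSpace ℝ E] [FiniteDimensional ℝ E]

/-- Two continuous maps that agree on the intersection of two closed sets are glued to a globally
defined continuous map. -/
theorem exists_continuous_eqOn_eqOn {A : Type*} [TopologicalSpace A] [NormalSpace A]
    {s t : Set A} (hs : IsClosed s) (ht : IsClosed t) {f g : A → E} (hf : Continuous f)
    (hg : Continuous g) (hfg : EqOn f g (s ∩ t)) :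
    ∃ F : A → E, Continuous F ∧ EqOn F f s ∧ EqOn F g t := by
  classical
  have hpf : EqOn (s.piecewise f g) f s := fun x hx => piecewise_eq_of_mem _ _ _ hx
  have hpg : EqOn (s.piecewise f g) g t := fun x hx => by
    by_cases hxs : x ∈ s
    · rw [hpf hxs, hfg ⟨hxs, hx⟩]
    · exact piecewise_eq_of_notMem _ _ _ hxs
  have hc : ContinuousOn (s.piecewise f g) (s ∪ t) :=
    (hf.continuousOn.congr hpf).union_of_isClosed (hg.continuousOn.congr hpg) hs ht
  obtain ⟨F, hF⟩ := ContinuousMap.exists_restrict_eq (hs.union ht)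
    (⟨_, hc.domRestrict⟩ : C((s ∪ t : Set A), E))
  have hF' : EqOn F (s.piecewise f g) (s ∪ t) := fun x hx => DFunLike.congr_fun hF ⟨x, hx⟩
  exact ⟨F, F.continuous, fun x hx => (hF' (Or.inl hx)).trans (hpf hx),
    fun x hx => (hF' (Or.inr hx)).trans (hpg hx)⟩

/-- The homotopy extension property for maps to `E \ {0}`. -/
theorem exists_nonvanishing_of_homotopy {A : Type*} [TopologicalSpace A] [T2Space A]
    [NormalSpace A] [NormalSpace (A × ℝ)] {Z Z₀ : Set A} (hZ : IsClosed Z) (hZ₀ : IsCompact Z₀)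
    {g : A → E} (hg : Continuous g) (hgZ : ∀ z ∈ Z, g z ≠ 0)
    {H : A × ℝ → E} (hH : Continuous H) (hH0 : ∀ z ∈ Z₀, H (z, 0) = g z)
    (hHne : ∀ z ∈ Z₀, ∀ s ∈ Icc (0 : ℝ) 1, H (z, s) ≠ 0) :
    ∃ g' : A → E, Continuous g' ∧ (∀ z ∈ Z, g' z ≠ 0) ∧ ∀ z ∈ Z₀, g' z = H (z, 1) := by
  obtain ⟨F, hF, hFH, hFg⟩ := exists_continuous_eqOn_eqOn (hZ₀.isClosed.prod isClosed_Icc)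
    (hZ.prod (isClosed_singleton (x := (0 : ℝ)))) hH (hg.comp continuous_fst)
    (s := Z₀ ×ˢ Icc (0 : ℝ) 1) (by
      rintro ⟨z, s⟩ ⟨⟨hz, -⟩, -, hs⟩
      obtain rfl : s = 0 := hs
      exact hH0 z hz)
  obtain ⟨O, I, hO, -, hZO, hI, hOI⟩ := generalized_tube_lemma hZ₀ (isCompact_Icc (a := (0 : ℝ))
    (b := 1)) (n := {x | F x ≠ 0}) (isOpen_ne_fun hF continuous_const) (by
      rintro ⟨z, s⟩ hzs
      have := hFH hzs
      simp only [mem_ofPred_eq, this]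
      exact hHne z hzs.1 s hzs.2)
  obtain ⟨l, hl0, hl1, hl⟩ := exists_continuous_zero_one_of_isClosed hO.isClosed_compl hZ₀.isClosed
    (disjoint_left.2 fun x hx hxZ => hx (hZO hxZ))
  refine ⟨fun z => F (z, l z), by fun_prop, fun z hz => ?_, fun z hz => ?_⟩
  · by_cases hzO : z ∈ O
    · exact hOI (⟨hzO, hI (hl z)⟩ : (z, l z) ∈ O ×ˢ I)
    · have h0 : l z = 0 := hl0 hzO
      have : F (z, 0) = g z := hFg ⟨hz, rfl⟩
      simp only [h0, this]
      exact hgZ z hz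
  · have h1 : l z = 1 := hl1 hz
    simp only [h1]
    exact hFH ⟨hz, by simp⟩

/-- Nonvanishing maps to `E` extend over subsets of spaces of dimension less than that of `E`. -/
theorem exists_nonvanishing_of_finrank_lt {P : Type*} [NormedAddCommGroup P] [NormedSpace ℝ P]
    [FiniteDimensional ℝ P] (hPE : Module.finrank ℝ P < Module.finrank ℝ E) {B : Set P}
    (hB : IsCompact B) {h : P → E} (hh : Continuous h) (hhB : ∀ t ∈ B, h t ≠ 0) :
    ∃ h' : P → E, Continuous h' ∧ EqOn h' h B ∧ ∀ t, h' t ≠ 0 := by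
  obtain ⟨δ, hδ, hδB⟩ : ∃ δ > 0, ∀ t ∈ B, δ < ‖h t‖ := by
    rcases B.eq_empty_or_nonempty with rfl | hne
    · exact ⟨1, one_pos, by simp⟩
    · obtain ⟨t₀, ht₀, hmin⟩ := hB.exists_isMinOn hne hh.norm.continuousOn
      have h0 : 0 < ‖h t₀‖ := norm_pos_iff.2 (hhB t₀ ht₀)
      exact ⟨‖h t₀‖ / 2, by positivity, fun t ht => (half_lt_self h0).trans_le (hmin ht)⟩
  obtain ⟨s, hs, hsh, -⟩ := hh.exists_contDiff_approx 1 (ε := fun _ => δ / 2) continuous_const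
    (fun _ => by positivity)
  obtain ⟨v, hv, hvδ⟩ := (ContDiff.dense_compl_range_of_finrank_lt_finrank (by exact_mod_cast hs)
    hPE).exists_dist_lt (0 : E) (half_pos hδ)
  have hclose : ∀ t, ‖(s t - v) - h t‖ < δ := fun t => by
    have h1 := hsh t
    rw [dist_eq_norm] at h1
    rw [dist_zero_left] at hvδ
    calc ‖(s t - v) - h t‖ = ‖(s t - h t) - v‖ := by congr 1; abel
      _ ≤ ‖s t - h t‖ + ‖v‖ := norm_sub_le _ _
      _ < δ := by linarith
  obtain ⟨l, hl0, hl1, hl⟩ := exists_continuous_zero_one_of_isClosed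
    (isClosed_le hh.norm continuous_const) hB.isClosed (s := {t | ‖h t‖ ≤ δ})
    (disjoint_left.2 fun x hx hxB => (hδB x hxB).not_ge hx)
  have hsc := hs.continuous
  refine ⟨fun t => (s t - v) + l t • (h t - (s t - v)), by fun_prop, fun t ht => ?_, fun t => ?_⟩
  · have h1 : l t = 1 := hl1 ht
    simp [h1]
  · by_cases ht : ‖h t‖ ≤ δ
    · have h0 : l t = 0 := hl0 ht
      simp only [h0, zero_smul, add_zero, sub_ne_zero]
      rintro rfl
      exact hv ⟨t, rfl⟩
    · intro h0
      have e : h t = -((1 - l t) • ((s t - v) - h t)) := by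
        rw [← sub_eq_zero, ← h0]
        module
      have h1 : |1 - l t| ≤ 1 := by
        rw [abs_le]
        constructor <;> linarith [(hl t).1, (hl t).2]
      refine ht ?_
      rw [e, norm_neg, norm_smul, Real.norm_eq_abs]
      exact (mul_le_of_le_one_left (norm_nonneg _) h1).trans (hclose t).le

variable {W : Type*} [MetricSpace W]

theorem exists_nonvanishing_of_fiber {P : Type*} [NormedAddCommGroup P] [NormedSpace ℝ P]
    [FiniteDimensional ℝ P] (hPE : Module.finrank ℝ P < Module.finrank ℝ E) (x : W) {T : Set P}
    (hT : IsCompact T) {C : Set (W × P)} (hC : IsClosed C) {g : W × P → E} (hg : Continuous g)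
    (hgC : ∀ z ∈ C, g z ≠ 0) :
    ∃ G : W × P → E, Continuous G ∧ EqOn G g C ∧ ∀ z ∈ ({x} : Set W) ×ˢ T, G z ≠ 0 := by
  obtain ⟨h', hh', heq, hne⟩ := exists_nonvanishing_of_finrank_lt hPE
    (B := T ∩ (fun t => (x, t)) ⁻¹' C) (hT.inter_right (hC.preimage (by fun_prop)))
    (h := fun t => g (x, t)) (by fun_prop) (fun t ht => hgC _ ht.2)
  obtain ⟨G, hG, hGg, hGh⟩ := exists_continuous_eqOn_eqOn hC
    ((isClosed_singleton (x := x)).prod hT.isClosed) hg (hh'.comp continuous_snd) (by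
      rintro ⟨y, t⟩ ⟨hC, hy, ht⟩
      obtain rfl : y = x := hy
      exact (heq ⟨ht, hC⟩).symm)
  refine ⟨G, hG, hGg, fun z hz => ?_⟩
  rw [hGh hz]
  exact hne _

/-- If nonvanishing maps extend to `M₁ × T`, to `M₂ × T`, and extend over `(M₁ ∩ M₂) × T × [0, 1]`,
then they extend over `(M₁ ∪ M₂) × T`. -/
theorem exists_nonvanishing_union {P : Type*} [NormedAddCommGroup P] [NormedSpace ℝ P]
    {T : Set P} (hT : IsCompact T) {M₁ M₂ : Set W} (hM₁ : IsCompact M₁) (hM₂ : IsCompact M₂)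
    {C : Set (W × P)} (hC : IsClosed C) {g : W × P → E} (hgC : ∀ z ∈ C, g z ≠ 0)
    (h₁ : ∃ G : W × P → E, Continuous G ∧ EqOn G g C ∧ ∀ z ∈ M₁ ×ˢ T, G z ≠ 0)
    (h₂ : ∃ G : W × P → E, Continuous G ∧ EqOn G g C ∧ ∀ z ∈ M₂ ×ˢ T, G z ≠ 0)
    (hD : ∀ (C' : Set (W × (P × ℝ))) (f : W × (P × ℝ) → E), IsClosed C' → Continuous f →
      (∀ z ∈ C', f z ≠ 0) → ∃ G : W × (P × ℝ) → E, Continuous G ∧ EqOn G f C' ∧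
        ∀ z ∈ (M₁ ∩ M₂) ×ˢ (T ×ˢ Icc (0 : ℝ) 1), G z ≠ 0) :
    ∃ G : W × P → E, Continuous G ∧ EqOn G g C ∧ ∀ z ∈ (M₁ ∪ M₂) ×ˢ T, G z ≠ 0 := by
  obtain ⟨g₁, hg₁, hg₁C, hg₁M⟩ := h₁
  obtain ⟨g₂, hg₂, hg₂C, hg₂M⟩ := h₂
  have hDc : IsCompact (M₁ ∩ M₂) := hM₁.inter hM₂
  set C₀ : Set (W × (P × ℝ)) := (fun z => (z.1, z.2.1)) ⁻¹' C
  set C₁ : Set (W × (P × ℝ)) := (M₁ ∩ M₂) ×ˢ (T ×ˢ {0, 1})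
  obtain ⟨F, hF, hFC, hFD⟩ := hD (C₀ ∪ C₁)
    (fun z => (1 - z.2.2) • g₁ (z.1, z.2.1) + z.2.2 • g₂ (z.1, z.2.1))
    ((hC.preimage (by fun_prop)).union
      (hDc.isClosed.prod (hT.isClosed.prod (toFinite {0, 1}).isClosed))) (by fun_prop) (by
      rintro ⟨x, t, s⟩ (hz | ⟨hx, ht, hs⟩)
      · have hz' : (x, t) ∈ C := hz
        simp only [hg₁C hz', hg₂C hz', ← add_smul, sub_add_cancel, one_smul]
        exact hgC _ hz'
      · rcases hs with hs | hs
        · obtain rfl : s = 0 := hs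
          simpa using hg₁M (x, t) ⟨hx.1, ht⟩
        · obtain rfl : s = 1 := hs
          simpa using hg₂M (x, t) ⟨hx.2, ht⟩)
  have hFC' : ∀ x t s, (x, t) ∈ C → F (x, t, s) = g (x, t) := fun x t s hz => by
    rw [hFC (Or.inl hz : (x, t, s) ∈ C₀ ∪ C₁)]
    simp only [hg₁C hz, hg₂C hz, ← add_smul, sub_add_cancel, one_smul]
  obtain ⟨g', hg', hg'M, hg'Z⟩ := exists_nonvanishing_of_homotopy (Z := M₁ ×ˢ T)
    (Z₀ := (M₁ ∩ M₂) ×ˢ T ∪ (M₁ ×ˢ T ∩ C)) (hM₁.isClosed.prod hT.isClosed)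
    ((hDc.prod hT).union ((hM₁.prod hT).inter_right hC)) hg₁ hg₁M
    (H := fun z => F (z.1.1, z.1.2, z.2)) (by fun_prop) (by
      rintro ⟨x, t⟩ (⟨hx, ht⟩ | ⟨-, hz⟩)
      · simp only
        rw [hFC (Or.inr ⟨hx, ht, by simp⟩ : (x, t, (0 : ℝ)) ∈ C₀ ∪ C₁)]
        simp
      · rw [hg₁C hz]
        exact hFC' _ _ _ hz) (by
      rintro ⟨x, t⟩ (⟨hx, ht⟩ | ⟨-, hz⟩) s hs
      · exact hFD _ ⟨hx, ht, hs⟩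
      · simp only [hFC' _ _ _ hz]
        exact hgC _ hz)
  obtain ⟨G, hG, hG₁, hG₂⟩ := exists_continuous_eqOn_eqOn (hM₁.isClosed.prod hT.isClosed)
    (hC.union (hM₂.isClosed.prod hT.isClosed)) hg' hg₂ (by
      rintro ⟨x, t⟩ ⟨hz₁, hz | hz⟩
      · rw [hg'Z _ (Or.inr ⟨hz₁, hz⟩), hg₂C hz]
        exact hFC' _ _ _ hz
      · have hx : x ∈ M₁ ∩ M₂ := ⟨hz₁.1, hz.1⟩
        rw [hg'Z _ (Or.inl ⟨hx, hz.2⟩)]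
        simp only
        rw [hFC (Or.inr ⟨hx, hz.2, by simp⟩ : (x, t, (1 : ℝ)) ∈ C₀ ∪ C₁)]
        simp)
  refine ⟨G, hG, fun z hz => (hG₂ (Or.inl hz)).trans (hg₂C hz), ?_⟩
  rintro z ⟨hz | hz, ht⟩
  · rw [hG₁ ⟨hz, ht⟩]
    exact hg'M _ ⟨hz, ht⟩
  · rw [hG₂ (Or.inr ⟨hz, ht⟩)]
    exact hg₂M _ ⟨hz, ht⟩

/-- Nonvanishing maps into `E` extend over `K × T` when the dimension of `K`, measured by the
failure of `IsThick`, plus that of the parameter space is less than the dimension of `E`. -/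
theorem exists_nonvanishing_of_not_isThick {n : ℕ} :
    ∀ {P : Type} [NormedAddCommGroup P] [NormedSpace ℝ P] [FiniteDimensional ℝ P],
      Module.finrank ℝ E = n + Module.finrank ℝ P → ∀ {T : Set P}, IsCompact T →
      ∀ {K : Set W}, IsCompact K → ¬ IsThick n K →
      ∀ (C : Set (W × P)) (g : W × P → E), IsClosed C → Continuous g → (∀ z ∈ C, g z ≠ 0) →
      ∃ G : W × P → E, Continuous G ∧ EqOn G g C ∧ ∀ z ∈ K ×ˢ T, G z ≠ 0 := by
  induction n with
  | zero =>
    intro P _ _ _ _ T _ K _ hK C g _ hg _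
    obtain rfl : K = ∅ := not_nonempty_iff_eq_empty.1 hK
    exact ⟨g, hg, fun _ _ => rfl, by simp⟩
  | succ n ih =>
    intro P _ _ _ hfin T hT K hKc hK C g hC hg hgC
    let Good : Set W → Prop := fun M =>
      ∃ G : W × P → E, Continuous G ∧ EqOn G g C ∧ ∀ z ∈ M ×ˢ T, G z ≠ 0
    change Good K
    by_contra hbad
    obtain ⟨M, hMK, hM⟩ : ∃ M ⊆ K, Minimal (fun M => IsCompact M ∧ ¬ Good M) M := by
      refine zorn_superset_nonempty {M | IsCompact M ∧ ¬ Good M} ?_ K ⟨hKc, hbad⟩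
      intro c hc hchain hne
      have hcomp : IsCompact (⋂₀ c) := by
        obtain ⟨s, hs⟩ := hne
        exact (hc hs).1.of_isClosed_subset (isClosed_sInter fun t ht => (hc ht).1.isClosed)
          (sInter_subset_of_mem hs)
      refine ⟨⋂₀ c, ⟨hcomp, ?_⟩, fun s hs => sInter_subset_of_mem hs⟩
      rintro ⟨G, hG, hGC, hGM⟩
      obtain ⟨u, v, hu, -, hcu, hTv, huv⟩ := generalized_tube_lemma hcomp hT
        (n := {z | G z ≠ 0}) (isOpen_ne_fun hG continuous_const) hGM
      have : Nonempty c := hne.to_subtype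
      obtain ⟨⟨s, hs⟩, hsu⟩ := exists_subset_nhds_of_isCompact (V := ((↑) : c → Set W))
        (fun i j => (hchain.total i.2 j.2).elim (fun h => ⟨i, subset_rfl, h⟩)
          (fun h => ⟨j, h, subset_rfl⟩)) (fun i => (hc i.2).1)
        (U := u) (fun x hx => hu.mem_nhds (hcu (by rwa [sInter_eq_iInter])))
      exact (hc hs).2 ⟨G, hG, hGC, fun z hz => huv ⟨hsu hz.1, hTv hz.2⟩⟩
    have hgood : ∀ M' ⊆ M, M' ≠ M → IsCompact M' → Good M' := fun M' hsub hne hcomp => by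
      by_contra h
      exact hne (hsub.antisymm (hM.2 ⟨hcomp, h⟩ hsub))
    have hMnt : M.Nontrivial := by
      rw [← not_subsingleton_iff]
      intro hsub
      rcases hsub.eq_empty_or_singleton with rfl | ⟨x, rfl⟩
      · exact hM.1.2 ⟨g, hg, fun _ _ => rfl, by simp⟩
      · exact hM.1.2 (exists_nonvanishing_of_fiber (by omega) x hT hC hg hgC)
    refine hK ⟨M, hMK, hM.1.1, hMnt, fun M₁ M₂ h₁ h₂ hu hn₁ hn₂ => ?_⟩
    by_contra hthin
    refine hM.1.2 (hu ▸ exists_nonvanishing_union hT h₁ h₂ hC hgC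
      (hgood M₁ (hu ▸ subset_union_left) hn₁ h₁) (hgood M₂ (hu ▸ subset_union_right) hn₂ h₂) ?_)
    intro C' f hC' hf hfC'
    exact ih (by rw [Module.finrank_prod, Module.finrank_self]; omega) (hT.prod isCompact_Icc)
      (h₁.inter h₂) hthin C' f hC' hf hfC'

end Extension

section NoRetraction

open MeasureTheory Polynomial

variable {E : Type*} [NormedAddCommGroup E]

theorem continuous_coeff_finset_prod {A R ι : Type*} [TopologicalSpace A] [CommSemiring R]
    [TopologicalSpace R] [IsTopologicalSemiring R] (s : Finset ι) {p : ι → A → R[X]}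
    (hp : ∀ i ∈ s, ∀ k, Continuous fun x => (p i x).coeff k) (k : ℕ) :
    Continuous fun x => (∏ i ∈ s, p i x).coeff k := by
  classical
  induction s using Finset.induction_on generalizing k with
  | empty => simpa using continuous_const
  | insert i s hi ih =>
    simp only [Finset.prod_insert hi, coeff_mul]
    refine continuous_finsetSum _ fun j _ => (hp i (Finset.mem_insert_self i s) _).mul
      (ih (fun l hl => hp l (Finset.mem_insert_of_mem hl)) _)

theorem exists_polynomial_eval_eq_integral_det [NormedSpace ℝ E] [FiniteDimensional ℝ E]
    [MeasurableSpace E] [BorelSpace E] (μ : Measure E) [IsFiniteMeasureOnCompacts μ]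
    {A : E → E →L[ℝ] E} (hA : Continuous A) {s : Set E} (hs : IsCompact s) :
    ∃ P : ℝ[X], ∀ t : ℝ, P.eval t = ∫ x in s, (ContinuousLinearMap.id ℝ E + t • A x).det ∂μ := by
  classical
  let b := Module.finBasis ℝ E
  let M : E → Matrix _ _ ℝ := fun x => LinearMap.toMatrix b b (A x : E →ₗ[ℝ] E)
  let Q : E → ℝ[X] := fun x =>
    Matrix.det ((X : ℝ[X]) • (M x).map C + (1 : Matrix _ _ ℝ).map C)
  have hM : ∀ i j, Continuous fun x => M x i j := fun i j => by
    have : (fun x => M x i j) = fun x => b.coord i (A x (b j)) := by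
      funext x
      simp [M, LinearMap.toMatrix_apply]
    rw [this]
    exact (b.coord i).continuous_of_finiteDimensional.comp (by fun_prop)
  have hQ : ∀ k, Continuous fun x => (Q x).coeff k := fun k => by
    simp only [Q, Matrix.det_apply, finsetSum_coeff, coeff_smul]
    refine continuous_finsetSum _ fun σ _ => ?_
    refine Continuous.const_smul (continuous_coeff_finset_prod _ (fun i _ k => ?_) k) _
    simp only [Matrix.add_apply, Matrix.smul_apply, Matrix.map_apply, smul_eq_mul, coeff_add]
    refine Continuous.add ?_ continuous_const
    cases k with
    | zero => simpa only [coeff_X_mul_zero] using continuous_const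
    | succ k =>
      simp only [coeff_X_mul, coeff_C]
      split_ifs
      exacts [hM _ _, continuous_const]
  have hdeg : ∀ x, (Q x).natDegree < Module.finrank ℝ E + 1 := fun x =>
    Nat.lt_succ_of_le ((natDegree_det_X_add_C_le (M x) 1).trans (by simp))
  have heval : ∀ x t, (Q x).eval t = (ContinuousLinearMap.id ℝ E + t • A x).det := fun x t => by
    rw [ContinuousLinearMap.det, ← LinearMap.det_toMatrix b, ← coe_evalRingHom, RingHom.map_det]
    congr 1
    ext i j
    by_cases hij : i = j <;>
      simp [M, LinearMap.toMatrix_apply, hij, add_comm, mul_comm t]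
  refine ⟨∑ k ∈ Finset.range (Module.finrank ℝ E + 1), C (∫ x in s, (Q x).coeff k ∂μ) * X ^ k,
    fun t => ?_⟩
  simp only [← heval, eval_eq_sum_range' (hdeg _)]
  have hint : ∀ k ∈ Finset.range (Module.finrank ℝ E + 1),
      Integrable (fun x => (Q x).coeff k * t ^ k) (μ.restrict s) := fun k _ =>
    ((hQ k).mul_const (t ^ k)).continuousOn.integrableOn_compact hs
  rw [integral_finsetSum _ hint]
  simp [eval_finsetSum, integral_mul_const]

theorem det_id_add_pos [NormedSpace ℝ E] [FiniteDimensional ℝ E] {B : E →L[ℝ] E} (hB : ‖B‖ < 1) :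
    0 < (ContinuousLinearMap.id ℝ E + B).det := by
  have hne : ∀ s ∈ Icc (0 : ℝ) 1, (ContinuousLinearMap.id ℝ E + s • B).det ≠ 0 := by
    intro s hs h0
    obtain ⟨v, hv, hv0⟩ := Submodule.exists_mem_ne_zero_of_ne_bot
      (LinearMap.bot_lt_ker_of_det_eq_zero h0).ne'
    have hv' : v + s • B v = 0 := hv
    have h1 : ‖v‖ = ‖s • B v‖ :=
      (congrArg norm (eq_neg_of_add_eq_zero_left hv')).trans (norm_neg _)
    have h2 : ‖s • B v‖ ≤ ‖B‖ * ‖v‖ := by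
      rw [norm_smul, Real.norm_of_nonneg hs.1]
      exact (mul_le_of_le_one_left (norm_nonneg _) hs.2).trans (B.le_opNorm v)
    nlinarith [norm_pos_iff.2 hv0]
  have hc : Continuous fun s : ℝ => (ContinuousLinearMap.id ℝ E + s • B).det :=
    ContinuousLinearMap.continuous_det.comp (by fun_prop)
  by_contra! hneg
  obtain ⟨s, hs, hs0⟩ := intermediate_value_Icc' zero_le_one hc.continuousOn
    (⟨by simpa using hneg, by simp [ContinuousLinearMap.det]⟩ :
      (0 : ℝ) ∈ Icc _ _)
  exact hne s hs hs0

/-- A map that is Lipschitz on a closed ball and vanishes on its boundary sphere stays Lipschitz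
after extension by zero. -/
theorem LipschitzOnWith.indicator_closedBall [NormedSpace ℝ E] {F : Type*} [NormedAddCommGroup F]
    {R : ℝ} {L : NNReal} {u : E → F} (hu : LipschitzOnWith L u (Metric.closedBall 0 R))
    (hu0 : ∀ x, ‖x‖ = R → u x = 0) :
    LipschitzWith L ((Metric.closedBall (0 : E) R).indicator u) := by
  have key : ∀ x ∈ Metric.closedBall (0 : E) R, ∀ y ∉ Metric.closedBall (0 : E) R,
      dist (u x) 0 ≤ L * dist x y := by
    intro x hx y hy
    rw [mem_closedBall_zero_iff] at hx hy
    obtain ⟨s, hs, hsR⟩ := intermediate_value_Icc zero_le_one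
      (f := fun s : ℝ => ‖AffineMap.lineMap x y s‖)
      (Continuous.continuousOn (by fun_prop))
      (⟨by simpa using hx, by simpa using (not_le.1 hy).le⟩ :
        R ∈ Icc _ _)
    have hz : AffineMap.lineMap x y s ∈ Metric.closedBall (0 : E) R :=
      mem_closedBall_zero_iff.2 (le_of_eq hsR)
    rw [← hu0 _ hsR]
    refine (hu.dist_le_mul x (mem_closedBall_zero_iff.2 hx) _ hz).trans ?_
    gcongr
    rw [dist_left_lineMap, Real.norm_of_nonneg hs.1]
    exact mul_le_of_le_one_left dist_nonneg hs.2
  refine LipschitzWith.of_dist_le_mul fun x y => ?_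
  by_cases hx : x ∈ Metric.closedBall (0 : E) R <;> by_cases hy : y ∈ Metric.closedBall (0 : E) R
  · simpa [indicator_of_mem hx, indicator_of_mem hy] using hu.dist_le_mul x hx y hy
  · rw [indicator_of_mem hx, indicator_of_notMem hy]
    exact key x hx y hy
  · rw [indicator_of_notMem hx, indicator_of_mem hy, dist_comm, dist_comm x]
    exact key y hy x hx
  · rw [indicator_of_notMem hx, indicator_of_notMem hy, dist_self]
    positivity

theorem bijective_id_add_of_lipschitzWith [NormedSpace ℝ E] [CompleteSpace E] {L : NNReal}
    (hL : L < 1) {u : E → E} (hu : LipschitzWith L u) :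
    Function.Bijective fun x => x + u x := by
  have happ : ApproximatesLinearOn (fun x => x + u x)
      ((ContinuousLinearEquiv.refl ℝ E : E ≃L[ℝ] E) : E →L[ℝ] E) univ L := by
    refine LipschitzOnWith.approximatesLinearOn ?_
    rw [lipschitzOnWith_univ]
    convert! hu
    ext x
    simp
  have hc : Subsingleton E ∨
      L < ‖((ContinuousLinearEquiv.refl ℝ E).symm : E →L[ℝ] E)‖₊⁻¹ := by
    rcases subsingleton_or_nontrivial E with h | h
    · exact Or.inl h
    · right
      simpa [ContinuousLinearMap.nnnorm_id] using hL
  exact ⟨injOn_univ.1 (happ.injOn hc), happ.surjective hc⟩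

variable [InnerProductSpace ℝ E] [FiniteDimensional ℝ E]

/-- There is no `C¹` map to a sphere that restricts to the identity of the sphere. -/
theorem not_contDiff_retraction {R : ℝ} (hR : 0 < R) {ρ : E → E} (hρ : ContDiff ℝ 1 ρ)
    (hρR : ∀ x, ‖ρ x‖ = R) (hρid : ∀ x, ‖x‖ = R → ρ x = x) : False := by
  borelize E
  set B := Metric.closedBall (0 : E) R with hB
  have hBc : IsCompact B := isCompact_closedBall 0 R
  set A : E → E →L[ℝ] E := fun x => fderiv ℝ ρ x - ContinuousLinearMap.id ℝ E with hA
  have hAc : Continuous A := (hρ.continuous_fderiv one_ne_zero).sub continuous_const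
  have hderiv : ∀ x, HasFDerivAt (fun x => ρ x - x) (A x) x := fun x =>
    ((hρ.differentiable one_ne_zero x).hasFDerivAt).sub (hasFDerivAt_id x)
  obtain ⟨P, hP⟩ := exists_polynomial_eval_eq_integral_det (volume : Measure E) hAc hBc
  obtain ⟨L₀, hL₀⟩ := (hρ.sub contDiff_id).contDiffOn.exists_lipschitzOnWith one_ne_zero
    (convex_closedBall (0 : E) R) hBc
  obtain ⟨L₁, hL₁⟩ := hBc.exists_bound_of_continuousOn hAc.continuousOn
  set L : ℝ := max 1 (max L₀ L₁) with hLdef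
  have hL1 : 1 ≤ L := le_max_left _ _
  have hsmall : ∀ t ∈ Ioo (0 : ℝ) L⁻¹, P.eval t = volume.real B := by
    rintro t ⟨ht0, htL⟩
    have htL' : t * L < 1 := by rwa [lt_inv_comm₀ ht0 (by positivity), ← one_div,
      lt_div_iff₀' ht0] at htL
    have ht1 : t ≤ 1 := by nlinarith
    set g : E → E := fun x => x + t • (ρ x - x) with hg
    set u : E → E := fun x => t • (ρ x - x) with hu
    have hlip : LipschitzWith (t.toNNReal * L₀) (B.indicator u) := by
      refine LipschitzOnWith.indicator_closedBall ?_ fun x hx => by simp [hu, hρid x hx]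
      refine LipschitzOnWith.of_dist_le_mul fun x hx y hy => ?_
      have := hL₀.dist_le_mul x hx y hy
      rw [dist_smul₀, Real.norm_of_nonneg ht0.le, NNReal.coe_mul, Real.coe_toNNReal _ ht0.le,
        mul_assoc]
      exact mul_le_mul_of_nonneg_left this ht0.le
    have hbij := bijective_id_add_of_lipschitzWith (L := t.toNNReal * L₀) (by
      rw [← NNReal.coe_lt_coe]
      refine lt_of_le_of_lt ?_ htL'
      rw [NNReal.coe_mul, Real.coe_toNNReal _ ht0.le]
      exact mul_le_mul_of_nonneg_left ((le_max_left _ _).trans (le_max_right _ _)) ht0.le) hlip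
    have hgB : ∀ x ∈ B, x + B.indicator u x = g x := fun x hx => by rw [indicator_of_mem hx]
    have hgi : InjOn g B := fun x hx y hy hxy => hbij.1 (by
      simp only [hgB x hx, hgB y hy, hxy])
    have himg : g '' B = B := by
      refine Subset.antisymm ?_ fun y hy => ?_
      · rintro _ ⟨x, hx, rfl⟩
        have : g x = (1 - t) • x + t • ρ x := by simp only [hg]; module
        rw [this]
        exact convex_closedBall (0 : E) R hx (mem_closedBall_zero_iff.2 (hρR x).le)
          (by linarith) ht0.le (by ring)
      · obtain ⟨x, hx⟩ := hbij.2 y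
        by_cases hxB : x ∈ B
        · exact ⟨x, hxB, by rw [← hgB x hxB]; exact hx⟩
        · simp only [indicator_of_notMem hxB, add_zero] at hx
          exact absurd (hx ▸ hy) hxB
    have hcv := integral_image_eq_integral_abs_det_fderiv_smul (f := g) (volume : Measure E)
      hBc.measurableSet (fun x _ => ((hasFDerivAt_id x).add
        ((hderiv x).const_smul t)).hasFDerivWithinAt) hgi (fun _ => (1 : ℝ))
    rw [himg] at hcv
    rw [hP, ← mul_one (volume.real B), ← smul_eq_mul, ← setIntegral_const, hcv]
    refine setIntegral_congr_fun hBc.measurableSet fun x hx => ?_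
    simp only [smul_eq_mul, mul_one]
    refine (abs_of_pos (det_id_add_pos ?_)).symm
    rw [norm_smul, Real.norm_of_nonneg ht0.le]
    refine lt_of_le_of_lt ?_ htL'
    gcongr
    exact (hL₁ x hx).trans ((le_max_right _ _).trans (le_max_right _ _))
  have hPC : P = C (volume.real B) := by
    refine eq_of_infinite_eval_eq _ _ ((Ioo_infinite (inv_pos.2 (zero_lt_one.trans_le hL1))).mono
      fun t ht => ?_)
    simpa using hsmall t ht
  have hdet : ∀ x, (ContinuousLinearMap.id ℝ E + (1 : ℝ) • A x).det = 0 := by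
    intro x
    have : ContinuousLinearMap.id ℝ E + (1 : ℝ) • A x = fderiv ℝ ρ x := by simp [hA]
    rw [this]
    by_contra hne
    obtain ⟨v, hv⟩ := ((LinearMap.equivOfDetNeZero _ hne).surjective (ρ x))
    have hv' : fderiv ℝ ρ x v = ρ x := hv
    have hconst : (fun y => inner ℝ (ρ y) (ρ y)) = fun _ => R ^ 2 := by
      funext y
      rw [real_inner_self_eq_norm_sq, hρR]
    have hd := (hρ.differentiable one_ne_zero x).hasFDerivAt
    have h1 := (hd.inner ℝ hd).unique (hconst ▸ hasFDerivAt_const (R ^ 2) x)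
    have h2 := DFunLike.congr_fun h1 v
    simp [hv', hρR] at h2
    exact hR.ne' h2
  have h1 := hP 1
  simp only [hdet, hPC, eval_C, integral_zero] at h1
  exact (ENNReal.toReal_pos (Metric.measure_closedBall_pos volume (0 : E) hR).ne'
    hBc.measure_lt_top.ne).ne' h1

/-- The identity of a sphere does not extend to a nonvanishing map on the ball. -/
theorem exists_eq_zero_of_eqOn_sphere {r : ℝ} (hr : 0 < r) {G : E → E} (hG : Continuous G)
    (hGid : ∀ x, ‖x‖ = r → G x = x) : ∃ x, ‖x‖ ≤ r ∧ G x = 0 := by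
  by_contra! hne
  set h : E → E := fun x => if ‖x‖ ≤ r then G x else x with hh
  have hc : Continuous h := Continuous.if_le hG continuous_id continuous_norm continuous_const hGid
  have hh0 : ∀ x, h x ≠ 0 := by
    intro x
    by_cases hx : ‖x‖ ≤ r
    · simpa [hh, hx] using hne x hx
    · simp only [hh, hx, if_false]
      rintro rfl
      exact hx (by simpa using hr.le)
  obtain ⟨H, hH, hHh, hHid, -⟩ := hc.exists_contDiff_approx_and_eqOn 1 (ε := fun x => ‖h x‖)
    hc.norm (fun x => norm_pos_iff.2 (hh0 x)) (S := {x | 2 * r ≤ ‖x‖}) (U := {x | r < ‖x‖})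
    (isClosed_le continuous_const continuous_norm)
    ((isOpen_lt continuous_const continuous_norm).mem_nhdsSet.2 fun x hx => by
      have : 2 * r ≤ ‖x‖ := hx
      change r < ‖x‖
      linarith)
    (contDiffOn_id.congr fun x hx => if_neg (not_le.2 hx))
  have hH0 : ∀ x, H x ≠ 0 := fun x hx => by
    have := hHh x
    rw [hx, dist_zero_left] at this
    exact this.false
  refine not_contDiff_retraction (R := 2 * r) (by positivity)
    (ρ := fun x => (2 * r) • ‖H x‖⁻¹ • H x) ?_ (fun x => ?_) fun x hx => ?_
  · have hH' : ContDiff ℝ 1 H := by exact_mod_cast hH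
    exact contDiff_const.smul (((hH'.norm ℝ hH0).inv fun x => norm_ne_zero_iff.2 (hH0 x)).smul hH')
  · rw [norm_smul, norm_smul, norm_inv, norm_norm, inv_mul_cancel₀ (norm_ne_zero_iff.2 (hH0 x)),
      mul_one, Real.norm_of_nonneg (by positivity)]
  · have : H x = x := by
      rw [hHid (hx.ge : 2 * r ≤ ‖x‖)]
      exact if_neg (by rw [hx]; linarith)
    simp only [this, hx, smul_smul]
    rw [mul_inv_cancel₀ (by positivity), one_smul]

end NoRetraction

theorem isThick_closedBall {m : ℕ} (c : EuclideanSpace ℝ (Fin m)) {r : ℝ} (hr : 0 < r) :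
    IsThick m (Metric.closedBall c r) := by
  by_contra hthin
  obtain ⟨G, hG, hGid, hGne⟩ := exists_nonvanishing_of_not_isThick
    (E := EuclideanSpace ℝ (Fin m)) (P := EuclideanSpace ℝ (Fin 0)) (by simp)
    (isCompact_univ) (isCompact_closedBall c r) hthin (Metric.sphere c r ×ˢ univ)
    (fun z => z.1 - c) (Metric.isClosed_sphere.prod isClosed_univ) (by fun_prop) (by
      rintro ⟨x, t⟩ ⟨hx, -⟩
      refine sub_ne_zero.2 fun h => ?_
      have hx' : dist x c = r := hx
      rw [show x = c from h, dist_self] at hx'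
      exact hr.ne hx')
  obtain ⟨x, hx, hx0⟩ := exists_eq_zero_of_eqOn_sphere hr (G := fun x => G (x + c, 0))
    (by fun_prop) (fun x hx => by
      simpa using hGid (⟨by simpa using hx, trivial⟩ :
        (x + c, (0 : EuclideanSpace ℝ (Fin 0))) ∈ Metric.sphere c r ×ˢ univ))
  exact hGne (x + c, 0) ⟨by simpa using hx, trivial⟩ hx0

theorem exists_closedBall_subset_inter_halfSpace {m : ℕ} {O : Set (EuclideanSpace ℝ (Fin m))}
    (hO : IsOpen O) {a : EuclideanSpace ℝ (Fin m)} (haO : a ∈ O) (ha : a ∈ halfSpace m) :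
    ∃ c r, 0 < r ∧ Metric.closedBall c r ⊆ O ∩ halfSpace m := by
  let v : EuclideanSpace ℝ (Fin m) := WithLp.toLp 2 fun _ => 1
  have hcont : Continuous fun s : ℝ => a + s • v := by fun_prop
  have hnear : ∀ᶠ s in 𝓝[>] (0 : ℝ), a + s • v ∈ O :=
    (hcont.continuousAt.eventually_mem (hO.mem_nhds (by simpa using haO))).filter_mono
      nhdsWithin_le_nhds
  obtain ⟨s, hsO, hs : 0 < s⟩ := (hnear.and self_mem_nhdsWithin).exists
  obtain ⟨ε, hε, hball⟩ := Metric.nhds_basis_closedBall.mem_iff.1 (hO.mem_nhds hsO)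
  refine ⟨a + s • v, min ε s, lt_min hε hs, fun z hz => ⟨hball
    (Metric.closedBall_subset_closedBall (min_le_left _ _) hz), fun i hi => ?_⟩⟩
  have h1 : ‖z i - (a i + s)‖ ≤ s := by
    have := (PiLp.norm_apply_le (z - (a + s • v)) i).trans
      ((mem_closedBall_iff_norm.1 hz).trans (min_le_right _ _))
    simpa [v] using this
  have h2 := ha i hi
  rw [Real.norm_eq_abs, abs_le] at h1
  linarith

/-- If `X` is a nonempty `m`-manifold, `Y` is an `n`-manifold with `n ≤ 3`, and
there is a Darboux injection `f : X → Y`, then `m ≤ n`. -/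
theorem darboux_injection_manifold_dim_le {X Y : Type*} [TopologicalSpace X]
    [TopologicalSpace Y] [Nonempty X] (m n : ℕ) (hm : 1 ≤ m) (hn1 : 1 ≤ n)
    (hn : n ≤ 3) (hX : IsManifoldOfDim m X) (hY : IsManifoldOfDim n Y)
    (f : X → Y) (hinj : Function.Injective f)
    (hdarboux : ∀ C : Set X, IsPreconnected C → IsPreconnected (f '' C)) :
    m ≤ n := by
  by_contra! hlt
  obtain ⟨x⟩ := ‹Nonempty X›
  obtain ⟨U, -, hxU, V, hV, ⟨e⟩⟩ := hX.2 x
  obtain ⟨O, hO, rfl⟩ := isOpen_induced_iff.1 hV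
  obtain ⟨c, r, hr, hsub⟩ := exists_closedBall_subset_inter_halfSpace hO (e ⟨x, hxU⟩).2
    (e ⟨x, hxU⟩).1.2
  classical
  let g : EuclideanSpace ℝ (Fin m) → X := fun z =>
    if hz : z ∈ Metric.closedBall c r then e.symm ⟨⟨z, (hsub hz).2⟩, (hsub hz).1⟩ else x
  have hg : (Metric.closedBall c r).domRestrict g = fun z : Metric.closedBall c r =>
      ((e.symm ⟨⟨z.1, (hsub z.2).2⟩, (hsub z.2).1⟩ : U) : X) := by
    ext z
    exact dif_pos z.2
  have hgc : ContinuousOn g (Metric.closedBall c r) := by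
    rw [continuousOn_iff_continuous_domRestrict, hg]
    fun_prop
  have hgi : InjOn g (Metric.closedBall c r) := by
    rw [injOn_iff_injective, hg]
    intro z w hzw
    simpa [Subtype.ext_iff] using e.symm.injective (Subtype.ext hzw)
  refine ((isThick_closedBall c hr).of_le hlt).not_sepDimLT_of_darboux (f ∘ g)
    (hinj.comp_injOn hgi) (fun C hC hCp => ?_) (mapsTo_univ _ _) hY.sepDimLT
  rw [image_comp]
  exact hdarboux _ (hCp.image g (hgc.mono hC))
end
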